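/- Let F be a discretely valued Henselian field with perfect residue field and let E₂/E₁/F be a tower of finitely ramified separable algebraic extensions. Then the Herbrand functions satisfy φ_{E₂/F} = φ_{E₁/F} ∘ φ_{E₂/E₁}, or equivalently ψ_{E₂/F} = ψ_{E₂/E₁} ∘ ψ_{E₁/F}, as functions [0,∞) → [0,∞). -/

import Mathlib

noncomputable section

open scoped Classical

/-- An additive `ℝ ∪ {⊤}`-valued valuation on a field `Ω`. -/
structure AddVal (Ω : Type*) [Field Ω] where
  v : Ω → WithTop ℝ
  v_zero : v 0 = ⊤
  v_ne_top : ∀ x : Ω, x ≠ 0 → v x ≠ ⊤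
  v_mul : ∀ x y : Ω, v (x * y) = v x + v y
  v_min_le_add : ∀ x y : Ω, min (v x) (v y) ≤ v (x + y)

namespace AddVal

variable {Ω : Type*} [Field Ω]

/-- `V` is normalized on `F`: its value group on `F^×` is exactly `ℤ`.
This encodes that `F` is a discretely valued field and `V` extends the
normalized discrete valuation `val_F` of `F`. -/
def IsNormalizedOn (V : AddVal Ω) (F : Type*) [Field F] [Algebra F Ω] : Prop :=
  (∀ x : F, x ≠ 0 → ∃ k : ℤ, V.v (algebraMap F Ω x) = ((k : ℝ) : WithTop ℝ)) ∧
    (∃ x : F, V.v (algebraMap F Ω x) = ((1 : ℝ) : WithTop ℝ))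

/-- Henselian property of the valued field `(F, val_F)` (simple-root Hensel lemma). -/
def IsHenselianOn (V : AddVal Ω) (F : Type*) [Field F] [Algebra F Ω] : Prop :=
  ∀ f : Polynomial F,
    (∀ i : ℕ, 0 ≤ V.v (algebraMap F Ω (f.coeff i))) →
      ∀ a₀ : F, 0 ≤ V.v (algebraMap F Ω a₀) →
        0 < V.v (algebraMap F Ω (Polynomial.eval a₀ f)) →
        V.v (algebraMap F Ω (Polynomial.eval a₀ (Polynomial.derivative f))) = 0 →
        ∃ a : F, Polynomial.eval a f = 0 ∧ 0 < V.v (algebraMap F Ω (a - a₀))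

/-- The residue field of `(F, val_F)` is perfect: in positive residue characteristic `p`,
the Frobenius is surjective on the residue field. -/
def HasPerfectResidueFieldOn (V : AddVal Ω) (F : Type*) [Field F] [Algebra F Ω] : Prop :=
  ∀ p : ℕ, p.Prime → 0 < V.v (algebraMap F Ω (p : F)) →
    ∀ x : F, 0 ≤ V.v (algebraMap F Ω x) →
      ∃ y : F, 0 ≤ V.v (algebraMap F Ω y) ∧ 0 < V.v (algebraMap F Ω (x - y ^ p))

/-- `e` is the (absolute) ramification index of `E` over the field on which `V` is
normalized: the value group of `E^×` is exactly `(1/e)ℤ`.  In particular `E` is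
finitely ramified. -/
def IsRamIdx (V : AddVal Ω) {K : Type*} [Field K] [Algebra K Ω]
    (E : IntermediateField K Ω) (e : ℕ) : Prop :=
  0 < e ∧
    (∀ x : ↥E, x ≠ 0 → ∃ k : ℤ, V.v (x : Ω) = ((((k : ℝ) / (e : ℝ) : ℝ)) : WithTop ℝ)) ∧
    (∃ x : ↥E, V.v (x : Ω) = (((1 / (e : ℝ) : ℝ)) : WithTop ℝ))

end AddVal

/-- The lower ramification relation `Ξ_r` on `K`-algebra embeddings of `E` into `Ω`,
where `e` is the absolute ramification index of `E` (over the normalization field of `V`):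
`σ Ξ_r τ` iff `val_M (σ x - τ x) ≥ e(M/E) (r+1)` for all integral `x` and any (equivalently
some) suitable Galois `M`; this is equivalent to `V.v (σ x - τ x) ≥ (r+1)/e` for all
integral `x`. -/
def xiRel {Ω : Type*} [Field Ω] (V : AddVal Ω) {K : Type*} [Field K] [Algebra K Ω]
    (E : IntermediateField K Ω) (e : ℕ) (r : ℝ) (σ τ : ↥E →ₐ[K] Ω) : Prop :=
  ∀ x : ↥E, 0 ≤ V.v (x : Ω) →
    ((((r + 1) / (e : ℝ) : ℝ)) : WithTop ℝ) ≤ V.v (σ x - τ x)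

/-- `g_t`: the (common) cardinality of a `Ξ_t`-equivalence class, realized as the
cardinality of the class of the inclusion `E ↪ Ω`. -/
def gfun {Ω : Type*} [Field Ω] (V : AddVal Ω) {K : Type*} [Field K] [Algebra K Ω]
    (E : IntermediateField K Ω) (e : ℕ) (t : ℝ) : ℕ :=
  Nat.card {σ : ↥E →ₐ[K] Ω // xiRel V E e t σ E.val}

/-- The Herbrand function `φ_{E/K}(r) = ∫_0^r (g_t / g_0) dt`. -/
def herbrand {Ω : Type*} [Field Ω] (V : AddVal Ω) {K : Type*} [Field K] [Algebra K Ω]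
    (E : IntermediateField K Ω) (e : ℕ) (r : ℝ) : ℝ :=
  ∫ t in (0:ℝ)..r, ((gfun V E e t : ℝ) / (gfun V E e 0 : ℝ))

/-- `E/K` is at most `l`-ramified: for every finite subextension `E₀/K` the relation
`Ξ^l = Ξ_{ψ_{E₀/K}(l)}` is trivial. -/
def atMostRamified {Ω : Type*} [Field Ω] (V : AddVal Ω) {K : Type*} [Field K] [Algebra K Ω]
    (E : IntermediateField K Ω) (l : ℝ) : Prop :=
  ∀ E₀ : IntermediateField K Ω, E₀ ≤ E → FiniteDimensional K ↥E₀ →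
    ∀ (e₀ : ℕ) (s : ℝ), V.IsRamIdx E₀ e₀ → 0 ≤ s → herbrand V E₀ e₀ s = l →
      ∀ σ τ : ↥E₀ →ₐ[K] Ω, xiRel V E₀ e₀ s σ τ → σ = τ

/-- Membership of `γ ∈ Γ_K` in the upper ramification subgroup `I_K^l`: for every
finite Galois subextension `M/K` (with ramification index `eM` and `ψ_{M/K}(l) = sM`),
the image of `γ` in `Gal(M/K)` lies in `Gal(M/K)^l = Gal(M/K)_{ψ_{M/K}(l)}`. -/
def inUpperRam {Ω : Type*} [Field Ω] (V : AddVal Ω) {K : Type*} [Field K] [Algebra K Ω]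
    (l : ℝ) (γ : Ω ≃ₐ[K] Ω) : Prop :=
  ∀ (M : IntermediateField K Ω) (eM : ℕ) (sM : ℝ),
    FiniteDimensional K ↥M → IsGalois K ↥M → V.IsRamIdx M eM → 0 ≤ sM →
      herbrand V M eM sM = l →
      xiRel V M eM sM (γ.toAlgHom.comp M.val) M.val

namespace AddVal

section Basic

variable {Ω : Type*} [Field Ω] (V : AddVal Ω)

theorem v_one : V.v 1 = 0 := by
  have h := V.v_mul 1 1
  rw [mul_one] at h
  have h1 := V.v_ne_top 1 one_ne_zero
  lift V.v 1 to ℝ using h1 with a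
  norm_cast at h ⊢
  linarith

/-- The valuation as a Mathlib `AddValuation`. -/
def toAddValuation : AddValuation Ω (WithTop ℝ) :=
  AddValuation.of V.v V.v_zero V.v_one V.v_min_le_add V.v_mul

theorem v_pow (x : Ω) (n : ℕ) : V.v (x ^ n) = n • V.v x :=
  V.toAddValuation.map_pow x n

theorem v_neg (x : Ω) : V.v (-x) = V.v x := V.toAddValuation.map_neg x

theorem v_sub_swap (x y : Ω) : V.v (x - y) = V.v (y - x) := V.toAddValuation.map_sub_swap x y

theorem le_v_add {x y : Ω} {a : WithTop ℝ} (hx : a ≤ V.v x) (hy : a ≤ V.v y) : a ≤ V.v (x + y) :=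
  V.toAddValuation.map_le_add hx hy

theorem lt_v_add {x y : Ω} {a : WithTop ℝ} (hx : a < V.v x) (hy : a < V.v y) : a < V.v (x + y) :=
  V.toAddValuation.map_lt_add hx hy

theorem le_v_sub {x y : Ω} {a : WithTop ℝ} (hx : a ≤ V.v x) (hy : a ≤ V.v y) : a ≤ V.v (x - y) :=
  V.toAddValuation.map_le_sub hx hy

theorem lt_v_sub {x y : Ω} {a : WithTop ℝ} (hx : a < V.v x) (hy : a < V.v y) : a < V.v (x - y) := by
  rw [sub_eq_add_neg]; exact V.lt_v_add hx (by rwa [V.v_neg])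

theorem v_add_eq_left {x y : Ω} (h : V.v x < V.v y) : V.v (x + y) = V.v x :=
  V.toAddValuation.map_add_eq_of_lt_left h

theorem le_v_sum {ι : Type*} (s : Finset ι) (f : ι → Ω) {a : WithTop ℝ}
    (h : ∀ i ∈ s, a ≤ V.v (f i)) : a ≤ V.v (∑ i ∈ s, f i) :=
  V.toAddValuation.map_le_sum h

theorem lt_v_sum {ι : Type*} (s : Finset ι) (f : ι → Ω) {a : WithTop ℝ} (ha : a ≠ ⊤)
    (h : ∀ i ∈ s, a < V.v (f i)) : a < V.v (∑ i ∈ s, f i) :=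
  V.toAddValuation.map_lt_sum ha h

theorem v_prod {ι : Type*} (s : Finset ι) (f : ι → Ω) :
    V.v (∏ i ∈ s, f i) = ∑ i ∈ s, V.v (f i) := by
  induction s using Finset.induction_on with
  | empty => simpa using V.v_one
  | insert a s ha ih => rw [Finset.prod_insert ha, Finset.sum_insert ha, V.v_mul, ih]

theorem v_eq_top_iff {x : Ω} : V.v x = ⊤ ↔ x = 0 :=
  ⟨fun h => by_contra fun hx => V.v_ne_top x hx h, fun h => h ▸ V.v_zero⟩

theorem exists_v_eq {x : Ω} (hx : x ≠ 0) : ∃ a : ℝ, V.v x = a := by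
  obtain ⟨a, ha⟩ := WithTop.ne_top_iff_exists.1 (V.v_ne_top x hx)
  exact ⟨a, ha.symm⟩

theorem v_inv {x : Ω} {a : ℝ} (h : V.v x = a) : V.v x⁻¹ = ((-a : ℝ) : WithTop ℝ) := by
  have hx : x ≠ 0 := by
    rintro rfl
    rw [V.v_zero] at h
    exact WithTop.coe_ne_top h.symm
  obtain ⟨b, hb⟩ := V.exists_v_eq (inv_ne_zero hx)
  have := V.v_mul x x⁻¹
  rw [mul_inv_cancel₀ hx, V.v_one, h, hb] at this
  rw [hb]
  norm_cast at this ⊢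
  linarith

theorem v_div {x y : Ω} {a b : ℝ} (hx : V.v x = a) (hy : V.v y = b) :
    V.v (x / y) = ((a - b : ℝ) : WithTop ℝ) := by
  rw [div_eq_mul_inv, V.v_mul, hx, V.v_inv hy]
  norm_cast

theorem v_pow_eq {x : Ω} {a : ℝ} (h : V.v x = a) (n : ℕ) :
    V.v (x ^ n) = ((n * a : ℝ) : WithTop ℝ) := by
  rw [V.v_pow, h, ← WithTop.coe_nsmul, nsmul_eq_mul]

theorem v_div_of_le {x y : Ω} {b : ℝ} {c : WithTop ℝ} (hy : V.v y = b) (hx : b + c ≤ V.v x) :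
    c ≤ V.v (x / y) := by
  rw [div_eq_mul_inv, V.v_mul, V.v_inv hy]
  revert hx
  generalize V.v x = u
  induction u <;> induction c
  · simp
  · simp
  · intro h; simp at h
  · intro h; norm_cast at h ⊢; linarith

theorem v_mul_nonneg {x y : Ω} (hx : 0 ≤ V.v x) (hy : 0 ≤ V.v y) : 0 ≤ V.v (x * y) := by
  rw [V.v_mul]; exact add_nonneg hx hy

theorem v_pow_nonneg {x : Ω} (hx : 0 ≤ V.v x) (n : ℕ) : 0 ≤ V.v (x ^ n) := by
  rw [V.v_pow]; exact nsmul_nonneg hx n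

theorem le_v_mul_left {x y : Ω} {a : WithTop ℝ} (hx : 0 ≤ V.v x) (hy : a ≤ V.v y) :
    a ≤ V.v (x * y) := by
  rw [V.v_mul]
  simpa using add_le_add hx hy

/-- The ring of integers of the valuation. -/
def integers : ValuationSubring Ω where
  carrier := {x | 0 ≤ V.v x}
  zero_mem' := by simp [V.v_zero]
  one_mem' := by simp [V.v_one]
  add_mem' := fun ha hb => V.le_v_add ha hb
  mul_mem' := fun ha hb => V.v_mul_nonneg ha hb
  neg_mem' := fun {x} ha => by simpa [V.v_neg] using ha
  mem_or_inv_mem' := fun x => by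
    by_cases hx : x = 0
    · left; simp [hx, V.v_zero]
    · obtain ⟨a, ha⟩ := V.exists_v_eq hx
      simp only [Set.mem_ofPred_eq, V.v_inv ha, ha]
      norm_cast
      rcases le_total 0 a with h | h
      · left; exact h
      · right; linarith

theorem mem_integers {x : Ω} : x ∈ V.integers ↔ 0 ≤ V.v x := Iff.rfl

theorem isUnit_integers_iff (x : V.integers) : IsUnit x ↔ V.v (x : Ω) = 0 := by
  have hx := V.mem_integers.1 x.2
  constructor
  · rintro ⟨u, rfl⟩
    have h := V.v_mul (u : V.integers) ((u⁻¹ : V.integersˣ) : V.integers)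
    have h1 : ((u : V.integers) : Ω) * (((u⁻¹ : V.integersˣ) : V.integers) : Ω) = 1 := by
      exact_mod_cast congrArg Subtype.val u.mul_inv
    rw [h1, V.v_one] at h
    have h2 := V.mem_integers.1 ((u⁻¹ : V.integersˣ) : V.integers).2
    exact ((add_eq_zero_iff_of_nonneg hx h2).1 h.symm).1
  · intro h
    have h0 : (x : Ω) ≠ 0 := fun h0 => by simp [h0, V.v_zero] at h
    have hi : V.v (x : Ω)⁻¹ = 0 := by
      have := V.v_inv (a := 0) (x := (x : Ω)) (by simpa using h)
      simpa using this
    refine IsUnit.of_mul_eq_one ⟨(x : Ω)⁻¹, V.mem_integers.2 hi.ge⟩ (Subtype.ext ?_)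
    exact mul_inv_cancel₀ h0

theorem mem_maximalIdeal_iff (x : V.integers) :
    x ∈ IsLocalRing.maximalIdeal V.integers ↔ 0 < V.v (x : Ω) := by
  rw [IsLocalRing.mem_maximalIdeal, mem_nonunits_iff, isUnit_integers_iff]
  exact ⟨fun h => lt_of_le_of_ne (V.mem_integers.1 x.2) (Ne.symm h), fun h => h.ne'⟩

end Basic

open Polynomial

section Conjugates

variable {F Ω : Type*} [Field F] [Field Ω] [Algebra F Ω] [IsGalois F Ω]

variable (F) in
/-- The finite set of conjugates of `x` over `F`. -/
def conj (x : Ω) : Finset Ω := ((minpoly F x).aroots Ω).toFinset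

theorem mem_conj {x z : Ω} : z ∈ conj F x ↔ ∃ s : Ω ≃ₐ[F] Ω, s x = z := by
  have hx : IsIntegral F x := IsGalois.integral F x
  rw [conj, Multiset.mem_toFinset, Polynomial.mem_aroots]
  constructor
  · rintro ⟨-, h⟩
    have h1 : minpoly F x = minpoly F z :=
      minpoly.eq_of_irreducible_of_monic (minpoly.irreducible hx) h (minpoly.monic hx)
    obtain ⟨s, hs⟩ := (Normal.minpoly_eq_iff_mem_orbit Ω).1 h1.symm
    exact ⟨s, hs⟩
  · rintro ⟨s, rfl⟩
    refine ⟨minpoly.ne_zero hx, ?_⟩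
    rw [← minpoly.algEquiv_eq s x]
    exact minpoly.aeval F (s x)

theorem minpoly_map_eq_prod (x : Ω) :
    (minpoly F x).map (algebraMap F Ω) = ∏ z ∈ conj F x, (X - C z) := by
  have hx : IsIntegral F x := IsGalois.integral F x
  have h1 : ((minpoly F x).map (algebraMap F Ω)).Splits := Normal.splits inferInstance x
  have h2 := h1.eq_prod_roots_of_monic ((minpoly.monic hx).map _)
  have h3 : (minpoly F x).aroots Ω = (conj F x).val := by
    rw [conj, Multiset.toFinset_val, Multiset.dedup_eq_self.2]
    exact nodup_roots (Separable.map (IsGalois.separable F x))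
  rw [h2, Finset.prod, ← h3]

theorem image_conj (s : Ω ≃ₐ[F] Ω) (x : Ω) : (conj F x).image s = conj F x := by
  ext z
  rw [Finset.mem_image]
  constructor
  · rintro ⟨w, hw, rfl⟩
    obtain ⟨t, rfl⟩ := mem_conj.1 hw
    exact mem_conj.2 ⟨s * t, rfl⟩
  · intro hz
    obtain ⟨t, rfl⟩ := mem_conj.1 hz
    exact ⟨s.symm (t x), mem_conj.2 ⟨s⁻¹ * t, rfl⟩, by simp⟩

end Conjugates

section Invariance

variable {F Ω : Type*} [Field F] [Field Ω] [Algebra F Ω] (V : AddVal Ω)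

theorem exists_integers_prod (Z : Finset Ω) (hZ : ∀ z ∈ Z, 0 ≤ V.v z) :
    ∃ f : V.integers[X], f.Monic ∧ f.map V.integers.subtype = ∏ z ∈ Z, (X - C z) := by
  refine ⟨∏ z ∈ Z.attach, (X - C (⟨z.1, hZ z.1 z.2⟩ : V.integers)),
    monic_prod_of_monic _ _ fun _ _ => monic_X_sub_C _, ?_⟩
  rw [Polynomial.map_prod]
  conv_rhs => rw [← Finset.prod_attach]
  exact Finset.prod_congr rfl fun z _ => by
    rw [Polynomial.map_sub, Polynomial.map_X, Polynomial.map_C]; rfl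

theorem coeff_prod_nonneg (Z : Finset Ω) (hZ : ∀ z ∈ Z, 0 ≤ V.v z) (i : ℕ) :
    0 ≤ V.v ((∏ z ∈ Z, (X - C z)).coeff i) := by
  obtain ⟨f, -, hf⟩ := V.exists_integers_prod Z hZ
  rw [← hf, coeff_map]
  exact V.mem_integers.1 (f.coeff i).2

/-- Over a Henselian field there is no element all of whose nontrivial conjugates are in the
maximal ideal and whose trace is `1`. -/
theorem not_isHenselianOn_of_conj [IsGalois F Ω] {γ : Ω} (hγ : V.v γ = 0)
    (hconj : ∀ z ∈ conj F γ, z ≠ γ → 0 < V.v z) (hsum : ∑ z ∈ conj F γ, z = 1)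
    (hne : ∃ z ∈ conj F γ, z ≠ γ) : ¬ V.IsHenselianOn F := by
  intro hens
  have hγm : γ ∈ conj F γ := mem_conj.2 ⟨1, rfl⟩
  have hint : ∀ z ∈ conj F γ, 0 ≤ V.v z := fun z hz => by
    by_cases h : z = γ
    · rw [h, hγ]
    · exact (hconj z hz h).le
  have h1 : 0 < V.v (1 - γ) := by
    have : 1 - γ = ∑ z ∈ (conj F γ).erase γ, z := by
      rw [← hsum, ← Finset.add_sum_erase _ _ hγm]; ring
    rw [this]
    exact V.lt_v_sum _ _ WithTop.zero_ne_top fun z hz =>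
      hconj z (Finset.mem_of_mem_erase hz) (Finset.ne_of_mem_erase hz)
  have h1' : ∀ z ∈ conj F γ, 0 ≤ V.v (1 - z) := fun z hz =>
    V.le_v_sub V.v_one.ge (hint z hz)
  have h1u : ∀ z ∈ (conj F γ).erase γ, V.v (1 - z) = 0 := fun z hz => by
    have := hconj z (Finset.mem_of_mem_erase hz) (Finset.ne_of_mem_erase hz)
    rw [sub_eq_add_neg, V.v_add_eq_left, V.v_one]
    rwa [V.v_one, V.v_neg]
  have key := hens (minpoly F γ) (fun i => by
      rw [← coeff_map, minpoly_map_eq_prod]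
      exact V.coeff_prod_nonneg _ hint i) 1 (by rw [map_one, V.v_one]) (by
      rw [← eval₂_at_apply, ← eval_map, minpoly_map_eq_prod, map_one, eval_prod,
        ← Finset.mul_prod_erase _ _ hγm, V.v_mul]
      refine add_pos_of_pos_of_nonneg (by simpa using h1) ?_
      rw [V.v_prod]
      exact Finset.sum_nonneg fun z hz => by simpa using h1' z (Finset.mem_of_mem_erase hz)) (by
      rw [← eval₂_at_apply, ← eval_map, ← derivative_map, minpoly_map_eq_prod, map_one,
        ← Finset.mul_prod_erase _ _ hγm, derivative_mul, eval_add, eval_mul, eval_mul]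
      have e1 : V.v (eval 1 (∏ z ∈ (conj F γ).erase γ, (X - C z))) = 0 := by
        rw [eval_prod, V.v_prod]
        exact Finset.sum_eq_zero fun z hz => by simpa using h1u z hz
      obtain ⟨f, -, hf⟩ := V.exists_integers_prod ((conj F γ).erase γ)
        fun z hz => hint z (Finset.mem_of_mem_erase hz)
      have e2 : 0 ≤ V.v (eval 1 (derivative (∏ z ∈ (conj F γ).erase γ, (X - C z)))) := by
        rw [← hf, derivative_map, ← map_one V.integers.subtype, eval_map_apply]
        exact V.mem_integers.1 (eval 1 (derivative f)).2
      rw [V.v_add_eq_left]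
      · simp [e1]
      · simp only [derivative_sub, derivative_X, derivative_C, sub_zero, eval_one, one_mul, e1,
          V.v_mul, eval_sub, eval_X, eval_C]
        exact add_pos_of_pos_of_nonneg h1 e2)
  obtain ⟨a, ha, -⟩ := key
  have hx : IsIntegral F γ := IsGalois.integral F γ
  have hdeg := degree_eq_one_of_irreducible_of_root (minpoly.irreducible hx) ha
  obtain ⟨b, hb⟩ := minpoly.mem_range_of_degree_eq_one F γ hdeg
  obtain ⟨z, hz, hzne⟩ := hne
  obtain ⟨s, rfl⟩ := mem_conj.1 hz
  exact hzne (by rw [← hb]; exact s.commutes b)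

theorem v_algEquiv [IsGalois F Ω] (hens : V.IsHenselianOn F) (s : Ω ≃ₐ[F] Ω) (α : Ω) :
    V.v (s α) = V.v α := by
  by_contra hne
  have hα : α ≠ 0 := by rintro rfl; simp at hne
  set Y := conj F α with hY
  have hαY : α ∈ Y := mem_conj.2 ⟨1, rfl⟩
  have hsY : s α ∈ Y := mem_conj.2 ⟨s, rfl⟩
  have hY0 : ∀ y ∈ Y, y ≠ 0 := fun y hy => by
    obtain ⟨t, rfl⟩ := mem_conj.1 hy
    simpa using hα
  have htrans : ∀ y ∈ Y, ∀ z ∈ Y, ∃ t : Ω ≃ₐ[F] Ω, t y = z := fun y hy z hz => by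
    obtain ⟨t, rfl⟩ := mem_conj.1 hy
    obtain ⟨u, rfl⟩ := mem_conj.1 hz
    exact ⟨u * t⁻¹, by simp⟩
  obtain ⟨m, hm, hmin⟩ := Finset.exists_min_image Y V.v ⟨α, hαY⟩
  set S := Y.filter fun y => V.v y = V.v m with hS
  have hmS : m ∈ S := Finset.mem_filter.2 ⟨hm, rfl⟩
  obtain ⟨μ, hμ⟩ := V.exists_v_eq (hY0 m hm)
  have hvS : ∀ t : Ω ≃ₐ[F] Ω, S.image t ≠ S → V.v (∏ y ∈ S, y) < V.v (t (∏ y ∈ S, y)) := by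
    intro t ht
    rw [map_prod, V.v_prod, V.v_prod]
    have h1 : ∀ y ∈ S, t y ∈ Y := fun y hy => by
      rw [hY, ← image_conj t α]
      exact Finset.mem_image_of_mem _ (Finset.mem_filter.1 hy).1
    have h2 : ∃ y ∈ S, t y ∉ S := by
      by_contra hcon
      push Not at hcon
      exact ht (Finset.eq_of_subset_of_card_le (Finset.image_subset_iff.2 hcon)
        (Finset.card_image_of_injective _ t.injective).ge)
    obtain ⟨y, hy, hty⟩ := h2
    rw [← Finset.add_sum_erase _ _ hy, ← Finset.add_sum_erase _ _ hy]
    have h3 : V.v y < V.v (t y) := by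
      rw [(Finset.mem_filter.1 hy).2]
      refine lt_of_le_of_ne (hmin _ (h1 y hy)) fun h => hty (Finset.mem_filter.2 ⟨h1 y hy, h.symm⟩)
    have h4 : ∑ y ∈ S.erase y, V.v y ≤ ∑ y ∈ S.erase y, V.v (t y) :=
      Finset.sum_le_sum fun z hz => by
        have hz := Finset.mem_of_mem_erase hz
        rw [(Finset.mem_filter.1 hz).2]
        exact hmin _ (h1 z hz)
    refine WithTop.add_lt_add_of_lt_of_le ?_ h3 h4
    rw [← V.v_prod]
    exact V.v_ne_top _ (Finset.prod_ne_zero_iff.2 fun z hz =>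
      hY0 z (Finset.mem_filter.1 (Finset.mem_of_mem_erase hz)).1)
  have hex : ∃ t : Ω ≃ₐ[F] Ω, S.image t ≠ S := by
    obtain ⟨b, hbY, hbS⟩ : ∃ b ∈ Y, b ∉ S := by
      by_contra hcon
      push Not at hcon
      exact hne ((Finset.mem_filter.1 (hcon _ hsY)).2.trans (Finset.mem_filter.1 (hcon _ hαY)).2.symm)
    obtain ⟨t, ht⟩ := htrans m hm b hbY
    exact ⟨t, fun h => hbS (h ▸ Finset.mem_image.2 ⟨m, hmS, ht⟩)⟩
  set γ₀ := ∏ y ∈ S, y with hγ₀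
  have hγ₀0 : γ₀ ≠ 0 := Finset.prod_ne_zero_iff.2 fun z hz => hY0 z (Finset.mem_filter.1 hz).1
  have hdich : ∀ t : Ω ≃ₐ[F] Ω, t γ₀ ≠ γ₀ → V.v γ₀ < V.v (t γ₀) := fun t ht => by
    refine hvS t fun h => ht ?_
    rw [hγ₀, map_prod]
    conv_rhs => rw [← h]
    rw [Finset.prod_image t.injective.injOn]
  set Z := conj F γ₀ with hZ
  have hγZ : γ₀ ∈ Z := mem_conj.2 ⟨1, rfl⟩
  have htr : V.v (∑ z ∈ Z, z) = V.v γ₀ := by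
    rw [← Finset.add_sum_erase _ _ hγZ]
    refine V.v_add_eq_left (V.lt_v_sum _ _ (V.v_ne_top _ hγ₀0) fun z hz => ?_)
    obtain ⟨t, rfl⟩ := mem_conj.1 (Finset.mem_of_mem_erase hz)
    exact hdich t (Finset.ne_of_mem_erase hz)
  have htrF : (∑ z ∈ Z, z) ∈ Set.range (algebraMap F Ω) := by
    rw [InfiniteGalois.mem_range_algebraMap_iff_fixed]
    intro t
    rw [map_sum]
    conv_rhs => rw [hZ, ← image_conj t, Finset.sum_image t.injective.injOn]
  obtain ⟨c, hc⟩ := htrF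
  rw [← hc] at htr
  have hc0 : algebraMap F Ω c ≠ 0 := by
    intro h; rw [h, V.v_zero] at htr; exact V.v_ne_top _ hγ₀0 htr.symm
  obtain ⟨w, hw⟩ := V.exists_v_eq hγ₀0
  have htdiv : ∀ (t : Ω ≃ₐ[F] Ω) x, t (x / algebraMap F Ω c) = t x / algebraMap F Ω c := by
    intro t x; rw [map_div₀, t.commutes]
  have himg : conj F (γ₀ / algebraMap F Ω c) = Z.image (· / algebraMap F Ω c) := by
    ext z
    rw [mem_conj, Finset.mem_image]
    constructor
    · rintro ⟨t, rfl⟩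
      exact ⟨t γ₀, mem_conj.2 ⟨t, rfl⟩, (htdiv t _).symm⟩
    · rintro ⟨y, hy, rfl⟩
      obtain ⟨t, rfl⟩ := mem_conj.1 hy
      exact ⟨t, htdiv t _⟩
  refine V.not_isHenselianOn_of_conj (F := F) (γ := γ₀ / algebraMap F Ω c) ?_ ?_ ?_ ?_ hens
  · rw [V.v_div hw (htr.trans hw)]; simp
  · rw [himg]
    intro z hz hzne
    obtain ⟨y, hy, rfl⟩ := Finset.mem_image.1 hz
    obtain ⟨t, rfl⟩ := mem_conj.1 hy
    have h := hdich t fun h => hzne (by simp only [h])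
    obtain ⟨u, hu⟩ := V.exists_v_eq (x := t γ₀) (by simpa using hγ₀0)
    simp only [V.v_div hu (htr.trans hw)]
    rw [hu, hw] at h
    norm_cast at h ⊢
    linarith
  · rw [himg, Finset.sum_image fun a _ b _ h => by simpa [div_left_inj' hc0] using h,
      ← Finset.sum_div, ← hc, div_self hc0]
  · obtain ⟨t, ht⟩ := hex
    refine ⟨t γ₀ / algebraMap F Ω c, by rw [himg]; exact Finset.mem_image_of_mem _ (mem_conj.2 ⟨t, rfl⟩), ?_⟩
    intro h
    exact (hvS t ht).ne' (congrArg V.v ((div_left_inj' hc0).1 h))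

end Invariance

section Inertia

variable {Ω : Type*} [Field Ω] (V : AddVal Ω)

/-- The group of automorphisms of the valued field `Ω` which act trivially on the residue field
and fix the set `L` pointwise. -/
def inertia (L : Set Ω) : Subgroup (Ω ≃+* Ω) where
  carrier := {s | (∀ x, V.v (s x) = V.v x) ∧ (∀ x, 0 ≤ V.v x → 0 < V.v (s x - x)) ∧
    ∀ x ∈ L, s x = x}
  one_mem' := ⟨fun _ => rfl, fun x _ => by simp [V.v_zero], fun _ _ => rfl⟩
  mul_mem' := by
    rintro s t ⟨hs1, hs2, hs3⟩ ⟨ht1, ht2, ht3⟩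
    refine ⟨fun x => ?_, fun x hx => ?_, fun x hx => ?_⟩
    · rw [RingAut.mul_apply, hs1, ht1]
    · have : (s * t) x - x = (s (t x) - t x) + (t x - x) := by rw [RingAut.mul_apply]; ring
      rw [this]
      exact V.lt_v_add (hs2 _ (by rwa [ht1])) (ht2 _ hx)
    · rw [RingAut.mul_apply, ht3 x hx, hs3 x hx]
  inv_mem' := by
    rintro s ⟨hs1, hs2, hs3⟩
    have hv : ∀ x, V.v (s⁻¹ x) = V.v x := fun x => by
      rw [← hs1 (s⁻¹ x)]; exact congrArg V.v (s.apply_symm_apply x)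
    refine ⟨hv, fun x hx => ?_, fun x hx => ?_⟩
    · have := hs2 (s⁻¹ x) (by rwa [hv])
      rw [V.v_sub_swap]
      convert this using 3
      exact (s.apply_symm_apply x).symm
    · exact (RingEquiv.symm_apply_eq s).2 (hs3 x hx).symm

variable {V}

theorem inertia_mono {L L' : Set Ω} (h : L ⊆ L') : V.inertia L' ≤ V.inertia L :=
  fun _ hs => ⟨hs.1, hs.2.1, fun x hx => hs.2.2 x (h hx)⟩

theorem v_inertia {L : Set Ω} {s : Ω ≃+* Ω} (hs : s ∈ V.inertia L) (x : Ω) : V.v (s x) = V.v x :=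
  hs.1 x

theorem inertia_apply {L : Set Ω} {s : Ω ≃+* Ω} (hs : s ∈ V.inertia L) {x : Ω} (hx : x ∈ L) :
    s x = x := hs.2.2 x hx

end Inertia

section Lifting

variable {K Ω : Type*} [Field K] [Field Ω] [Algebra K Ω] (V : AddVal Ω)

variable (K) in
/-- `V` is invariant under the automorphisms of `Ω` over `K`. -/
def IsInvariantOver : Prop := ∀ (s : Ω ≃ₐ[K] Ω) (x : Ω), V.v (s x) = V.v x

variable {V}

theorem IsInvariantOver.intermediateField (h : V.IsInvariantOver K) (E : IntermediateField K Ω) :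
    V.IsInvariantOver E := fun s x => h (s.restrictScalars K) x

/-- An automorphism of the valued field `Ω` which acts trivially on the residue field of `K`
agrees on the residue field of `Ω` with some element of the Galois group. -/
theorem exists_algEquiv_congr [IsGalois K Ω] (hV : V.IsInvariantOver K) (s₀ : Ω ≃+* Ω)
    (hs : ∀ x, V.v (s₀ x) = V.v x)
    (hK : ∀ x : K, 0 ≤ V.v (algebraMap K Ω x) →
      0 < V.v (s₀ (algebraMap K Ω x) - algebraMap K Ω x)) :
    ∃ t : Ω ≃ₐ[K] Ω, ∀ x, 0 ≤ V.v x → 0 < V.v (t x - s₀ x) := by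
  let B := V.integers
  let A := B.comap (algebraMap K Ω)
  let i : A →+* B := ((algebraMap K Ω).comp A.subtype).codRestrict B.toSubring fun a => a.2
  let : Algebra A B := i.toAlgebra
  let : MulSemiringAction (Ω ≃ₐ[K] Ω) B :=
    { smul := fun s b => ⟨s b, V.mem_integers.2 (by rw [hV]; exact b.2)⟩
      one_smul := fun b => rfl
      mul_smul := fun s t b => rfl
      smul_zero := fun s => Subtype.ext (map_zero s)
      smul_add := fun s a b => Subtype.ext (map_add s _ _)
      smul_one := fun s => Subtype.ext (map_one s)
      smul_mul := fun s a b => Subtype.ext (map_mul s _ _) }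
  have hsmul : ∀ (s : Ω ≃ₐ[K] Ω) (b : B), ((s • b : B) : Ω) = s b := fun _ _ => rfl
  have : SMulCommClass (Ω ≃ₐ[K] Ω) A B := ⟨fun s a b => by
    rw [Algebra.smul_def, Algebra.smul_def]
    refine Subtype.ext ?_
    rw [hsmul]
    change s (algebraMap K Ω a * b) = algebraMap K Ω a * s b
    rw [map_mul, s.commutes]⟩
  have : Algebra.IsInvariant A B (Ω ≃ₐ[K] Ω) := ⟨fun b hb => by
    obtain ⟨a, ha⟩ := (InfiniteGalois.mem_range_algebraMap_iff_fixed (b : Ω)).2 fun s =>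
      congrArg Subtype.val (hb s)
    exact ⟨⟨a, by change algebraMap K Ω a ∈ B; rw [ha]; exact b.2⟩, Subtype.ext ha⟩⟩
  let : TopologicalSpace B := ⊥
  have : DiscreteTopology B := ⟨rfl⟩
  have : ContinuousSMul (Ω ≃ₐ[K] Ω) B := continuousSMul_iff_stabilizer_isOpen.2 fun b => by
    convert stabilizer_isOpen_of_isIntegral (K := K) (b : Ω) using 1
    ext s
    exact Subtype.ext_iff
  let Q := IsLocalRing.maximalIdeal B
  let sB : B ≃+* B :=
    { toFun := fun b => ⟨s₀ b, V.mem_integers.2 (by rw [hs]; exact b.2)⟩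
      invFun := fun b => ⟨s₀.symm b, V.mem_integers.2 (by
        rw [← hs, s₀.apply_symm_apply]; exact b.2)⟩
      left_inv := fun b => Subtype.ext (s₀.symm_apply_apply _)
      right_inv := fun b => Subtype.ext (s₀.apply_symm_apply _)
      map_mul' := fun a b => Subtype.ext (map_mul s₀ _ _)
      map_add' := fun a b => Subtype.ext (map_add s₀ _ _) }
  let e : B ⧸ Q ≃+* B ⧸ Q := Ideal.quotientEquiv Q Q sB (IsLocalRing.map_ringEquiv_maximalIdeal sB).symm
  let σ : (B ⧸ Q) ≃ₐ[A ⧸ Q.under A] (B ⧸ Q) := AlgEquiv.ofRingEquiv (f := e) (by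
    refine Quotient.ind fun a => ?_
    refine (Ideal.Quotient.eq (I := Q)).2 ((V.mem_maximalIdeal_iff _).2 ?_)
    exact hK a a.2)
  obtain ⟨t, ht⟩ := Ideal.Quotient.stabilizerHom_surjective_of_profinite (G := Ω ≃ₐ[K] Ω)
    (Q.under A) Q σ
  refine ⟨t.1, fun x hx => ?_⟩
  have h := DFunLike.congr_fun ht (Ideal.Quotient.mk Q ⟨x, hx⟩)
  exact (V.mem_maximalIdeal_iff _).1 ((Ideal.Quotient.eq (I := Q)).1 h)

theorem exists_algEquiv_extends [IsGalois K Ω] (E : IntermediateField K Ω) (σ : E →ₐ[K] Ω) :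
    ∃ s : Ω ≃ₐ[K] Ω, ∀ x : E, s x = σ x := by
  obtain ⟨φ, hφ⟩ := IntermediateField.exists_algHom_of_splits (L := E) (E := Ω) (K := Ω) (fun x =>
    ⟨IsGalois.integral K x, Normal.splits inferInstance x⟩) σ
  exact ⟨AlgEquiv.ofBijective φ (Algebra.IsAlgebraic.algHom_bijective φ), DFunLike.congr_fun hφ⟩

/-- A `K`-embedding of `E` acting trivially on residues extends to an inertial automorphism. -/
theorem exists_inertia_extends [IsGalois K Ω] (hV : V.IsInvariantOver K)
    (E : IntermediateField K Ω) (σ : E →ₐ[K] Ω)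
    (hσ : ∀ x : E, 0 ≤ V.v (x : Ω) → 0 < V.v (σ x - x)) :
    ∃ s ∈ V.inertia (Set.range (algebraMap K Ω)), ∀ x : E, s x = σ x := by
  obtain ⟨s₀, hs₀⟩ := exists_algEquiv_extends E σ
  obtain ⟨t, ht⟩ := exists_algEquiv_congr (hV.intermediateField E) s₀.toRingEquiv (hV s₀)
    fun x hx => by
      change 0 < V.v (s₀ x - x)
      rw [hs₀]; exact hσ x hx
  let t' : Ω ≃ₐ[K] Ω := t.restrictScalars K
  refine ⟨(s₀ * t'⁻¹ : Ω ≃ₐ[K] Ω).toRingEquiv, ⟨hV _, fun x hx => ?_, ?_⟩, fun x => ?_⟩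
  · have h := ht (t'⁻¹ x) (by rwa [hV])
    rwa [V.v_sub_swap, show t (t'⁻¹ x) = x from t'.apply_symm_apply x] at h
  · rintro _ ⟨x, rfl⟩
    exact AlgEquiv.commutes _ x
  · have h : t'⁻¹ (x : Ω) = x := t'.symm_apply_eq.2 (t.commutes x).symm
    change s₀ (t'⁻¹ x) = _
    rw [h, hs₀]

end Lifting

section Unramified

variable {K Ω : Type*} [Field K] [Field Ω] [Algebra K Ω] {V : AddVal Ω}

/-- An element fixed by the inertia group has the same valuation as some element of the base. -/
theorem exists_v_eq_of_fixed [IsGalois K Ω] (hV : V.IsInvariantOver K) {y : Ω} (hy : y ≠ 0)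
    (hfix : ∀ s ∈ V.inertia (Set.range (algebraMap K Ω)), s y = y) :
    ∃ z : K, V.v (algebraMap K Ω z) = V.v y := by
  let L := IntermediateField.adjoin K {y}
  have : FiniteDimensional K L :=
    IntermediateField.adjoin.finiteDimensional (IsGalois.integral K y)
  let yL : L := ⟨y, IntermediateField.mem_adjoin_simple_self K y⟩
  let O := V.integers.comap (algebraMap L Ω)
  have hvσ : ∀ (σ : L →ₐ[K] Ω) (x : L), V.v (σ x) = V.v (x : Ω) := fun σ x => by
    obtain ⟨s, hs⟩ := exists_algEquiv_extends L σ
    rw [← hs, hV]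
  let res := IsLocalRing.residue V.integers
  let χ : (L →ₐ[K] Ω) → O →* IsLocalRing.ResidueField V.integers := fun σ =>
    res.toMonoidHom.comp
      { toFun := fun a => ⟨σ a, V.mem_integers.2 (by rw [hvσ]; exact a.2)⟩
        map_one' := Subtype.ext (map_one σ)
        map_mul' := fun a b => Subtype.ext (map_mul σ _ _) }
  have hχ : Function.Injective χ := by
    intro σ τ h
    obtain ⟨t, ht⟩ := exists_algEquiv_extends L τ
    let ρ : L →ₐ[K] Ω := (t⁻¹ : Ω ≃ₐ[K] Ω).toAlgHom.comp σ
    have hρ : ∀ x : L, 0 ≤ V.v (x : Ω) → 0 < V.v (ρ x - x) := fun x hx => by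
      have h1 := DFunLike.congr_fun h ⟨x, hx⟩
      have h2 := (V.mem_maximalIdeal_iff _).1 ((Ideal.Quotient.eq).1 h1)
      have h3 : t (ρ x - x) = σ x - τ x := by
        rw [map_sub, ht]
        congr 1
        exact t.apply_symm_apply (σ x)
      rw [← hV t, h3]
      exact h2
    obtain ⟨s, hs, hsρ⟩ := exists_inertia_extends hV L ρ hρ
    have h4 : σ yL = τ yL := by
      have h5 : ρ yL = y := by rw [← hsρ]; exact hfix s hs
      rw [← ht, ← t.symm_apply_eq]
      exact h5
    refine IntermediateField.algHom_ext_of_eq_adjoin (S := L) (F := K) (s := {y}) rfl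
      fun x hx => ?_
    obtain rfl := Set.mem_singleton_iff.1 hx
    exact h4
  have hdiv : ∀ σ : L →ₐ[K] Ω, V.v (σ yL / y) = 0 := fun σ => by
    obtain ⟨a, ha⟩ := V.exists_v_eq hy
    rw [V.v_div ((hvσ σ yL).trans ha) ha]; simp
  let u : (L →ₐ[K] Ω) → V.integers := fun σ => ⟨σ yL / y, V.mem_integers.2 (hdiv σ).ge⟩
  have hu : ∀ σ, res (u σ) ≠ 0 := fun σ h => by
    have := (V.mem_maximalIdeal_iff _).1 ((IsLocalRing.residue_eq_zero_iff _).1 h)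
    exact this.ne' (hdiv σ)
  have hli := (linearIndependent_monoidHom O (IsLocalRing.ResidueField V.integers)).comp χ hχ
  rw [Fintype.linearIndependent_iff] at hli
  obtain ⟨a, ha⟩ : ∃ a : O, ∑ σ, res (u σ) * χ σ a ≠ 0 := by
    by_contra hcon
    push Not at hcon
    refine hu L.val (hli (fun σ => res (u σ)) ?_ L.val)
    ext a
    simpa using hcon a
  let w : Ω := ∑ σ : L →ₐ[K] Ω, σ (yL * a)
  have hw : w ∈ Set.range (algebraMap K Ω) := by
    rw [InfiniteGalois.mem_range_algebraMap_iff_fixed]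
    intro t
    rw [map_sum]
    refine Fintype.sum_bijective (fun σ : L →ₐ[K] Ω => t.toAlgHom.comp σ) ?_ _ _ fun σ => rfl
    refine Function.bijective_iff_has_inverse.2
      ⟨fun σ => (t⁻¹ : Ω ≃ₐ[K] Ω).toAlgHom.comp σ, fun σ => ?_, fun σ => ?_⟩
    · ext x; exact t.symm_apply_apply (σ x)
    · ext x; exact t.apply_symm_apply (σ x)
  obtain ⟨z, hz⟩ := hw
  refine ⟨z, ?_⟩
  let q : V.integers := ∑ σ : L →ₐ[K] Ω, u σ * ⟨σ a, V.mem_integers.2 (by rw [hvσ]; exact a.2)⟩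
  have hq : V.v (q : Ω) = 0 := by
    rw [← isUnit_integers_iff, ← IsLocalRing.residue_ne_zero_iff_isUnit]
    rw [map_sum]
    simpa [χ] using ha
  have hwq : w = y * q := by
    have : (q : Ω) = ∑ σ : L →ₐ[K] Ω, σ yL / y * σ a := by
      simp only [q]
      push_cast
      rfl
    rw [this, Finset.mul_sum]
    refine Finset.sum_congr rfl fun σ _ => ?_
    rw [map_mul]; field_simp
  rw [hz, hwq, V.v_mul, hq, add_zero]

variable (V K) in
/-- The inclusion of valuation rings. -/
def integersMap : V.integers.comap (algebraMap K Ω) →+* V.integers :=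
  ((algebraMap K Ω).comp (V.integers.comap (algebraMap K Ω)).subtype).codRestrict
    V.integers.toSubring fun a => a.2

theorem coe_integersMap (a : V.integers.comap (algebraMap K Ω)) :
    ((V.integersMap K a : V.integers) : Ω) = algebraMap K Ω a := rfl

theorem isLocalHom_integersMap : IsLocalHom (V.integersMap K) where
  map_nonunit a h := by
    have h1 : V.v (algebraMap K Ω a) = 0 := (V.isUnit_integers_iff _).1 h
    have h2 : (a : K) ≠ 0 := by
      intro h0
      rw [h0, map_zero, V.v_zero] at h1
      exact absurd h1 (by simp)
    have h3 : V.v (algebraMap K Ω (a : K)⁻¹) = 0 := by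
      rw [map_inv₀, V.v_inv (a := 0) (by simpa using h1)]; simp
    refine IsUnit.of_mul_eq_one ⟨(a : K)⁻¹, V.mem_integers.2 h3.ge⟩ ?_
    exact Subtype.ext (mul_inv_cancel₀ h2)

theorem residue_comap_eq_zero_iff (a : V.integers.comap (algebraMap K Ω)) :
    IsLocalRing.residue _ a = 0 ↔ 0 < V.v (algebraMap K Ω a) := by
  have := isLocalHom_integersMap (K := K) (V := V)
  rw [IsLocalRing.residue_eq_zero_iff, ← coe_integersMap, ← V.mem_maximalIdeal_iff,
    IsLocalRing.mem_maximalIdeal, IsLocalRing.mem_maximalIdeal, mem_nonunits_iff,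
    mem_nonunits_iff, isUnit_map_iff]

theorem perfectField_residueField (hp : V.HasPerfectResidueFieldOn K) :
    PerfectField (IsLocalRing.ResidueField (V.integers.comap (algebraMap K Ω))) := by
  set A := V.integers.comap (algebraMap K Ω)
  have hmem := residue_comap_eq_zero_iff (K := K) (V := V)
  obtain ⟨p, hp'⟩ := CharP.exists (IsLocalRing.ResidueField A)
  rcases CharP.char_is_prime_or_zero (IsLocalRing.ResidueField A) p with h | h
  · have := ExpChar.prime (R := IsLocalRing.ResidueField A) h
    have := PerfectRing.ofSurjective (IsLocalRing.ResidueField A) p fun x => by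
      obtain ⟨a, rfl⟩ := IsLocalRing.residue_surjective x
      have hp0 : 0 < V.v (algebraMap K Ω (p : K)) := by
        have := (hmem (p : A)).1 (by rw [map_natCast]; exact CharP.cast_eq_zero _ p)
        simpa using this
      obtain ⟨y, hy, hxy⟩ := hp p h hp0 a a.2
      refine ⟨IsLocalRing.residue A ⟨y, hy⟩, ?_⟩
      rw [frobenius_def, ← map_pow, eq_comm, ← sub_eq_zero, ← map_sub, hmem]
      exact hxy
    exact PerfectRing.toPerfectField _ p
  · subst h
    have := CharP.charP_to_charZero (IsLocalRing.ResidueField A)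
    infer_instance

/-- Every residue class of `Ω` contains an element fixed by the inertia group. -/
theorem exists_fixed_congr [IsSepClosed Ω] [IsGalois K Ω] (hV : V.IsInvariantOver K)
    (hp : V.HasPerfectResidueFieldOn K) {x : Ω} (hx : 0 ≤ V.v x) :
    ∃ a, 0 < V.v (x - a) ∧ ∀ s ∈ V.inertia (Set.range (algebraMap K Ω)), s a = a := by
  have := perfectField_residueField hp
  have hloc := isLocalHom_integersMap (K := K) (V := V)
  let A := V.integers.comap (algebraMap K Ω)
  let B := V.integers
  let i : A →+* B := V.integersMap K
  let kA := IsLocalRing.ResidueField A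
  let kB := IsLocalRing.ResidueField B
  let ρ : kA →+* kB := IsLocalRing.ResidueField.map i
  let _ : Algebra kA kB := ρ.toAlgebra
  have hcomm : ρ.comp (IsLocalRing.residue A) = (IsLocalRing.residue B).comp i :=
    IsLocalRing.ResidueField.map_comp_residue i
  have hKi : (algebraMap K Ω).comp A.subtype = B.subtype.comp i := rfl
  let xB : B := ⟨x, hx⟩
  have hconjint : ∀ z ∈ conj K x, 0 ≤ V.v z := fun z hz => by
    obtain ⟨s, rfl⟩ := mem_conj.1 hz
    rw [hV]; exact hx
  have hmint : minpoly K x ∈ lifts A.subtype := by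
    rw [lifts_iff_coeff_lifts]
    intro n
    refine ⟨⟨(minpoly K x).coeff n, ?_⟩, rfl⟩
    change 0 ≤ V.v (algebraMap K Ω _)
    rw [← coeff_map, minpoly_map_eq_prod]
    exact V.coeff_prod_nonneg _ hconjint n
  obtain ⟨m, hm, -, hmm⟩ :=
    lifts_and_natDegree_eq_and_monic hmint (minpoly.monic (IsGalois.integral K x))
  have hevalx : ∀ q : A[X], ((q.eval₂ i xB : B) : Ω) = (q.map A.subtype).aeval x := fun q => by
    rw [aeval_def, eval₂_map, hKi]
    exact (hom_eval₂ q i B.subtype xB)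
  have hres : ∀ (b : B) (q : A[X]), IsLocalRing.residue B (q.eval₂ i b) =
      (q.map (IsLocalRing.residue A)).aeval (IsLocalRing.residue B b) := fun b q => by
    rw [aeval_def, eval₂_map, hom_eval₂]
    rfl
  have hint : IsIntegral kA (IsLocalRing.residue B xB) := by
    refine ⟨m.map (IsLocalRing.residue A), hmm.map _, ?_⟩
    rw [← aeval_def, ← hres]
    have : m.eval₂ i xB = 0 := by
      apply Subtype.ext
      rw [hevalx, hm, minpoly.aeval]; rfl
    rw [this, map_zero]
  have hirr := minpoly.irreducible hint
  have hsep := PerfectField.separable_of_irreducible hirr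
  obtain ⟨g, hg, -, hgm⟩ := lifts_and_natDegree_eq_and_monic
    ((lifts_iff_coeff_lifts _).2 fun n =>
      IsLocalRing.residue_surjective ((minpoly kA (IsLocalRing.residue B xB)).coeff n))
    (minpoly.monic hint)
  have hgirr : Irreducible g := hgm.irreducible_of_irreducible_map (IsLocalRing.residue A) g
    (by rw [hg]; exact hirr)
  have hgK : Irreducible (g.map A.subtype) :=
    (hgm.irreducible_iff_irreducible_map_fraction_map (K := K)).1 hgirr
  have hgsep : (g.map A.subtype).Separable := by
    rw [separable_iff_derivative_ne_zero hgK, derivative_map]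
    intro h0
    have h1 : derivative g = 0 := map_injective A.subtype Subtype.val_injective (by
      rw [h0, Polynomial.map_zero])
    have h2 := hsep.aeval_derivative_ne_zero (minpoly.aeval kA (IsLocalRing.residue B xB))
    rw [← hg, derivative_map, h1, Polynomial.map_zero, map_zero] at h2
    exact h2 rfl
  have hsplit : ((g.map A.subtype).map (algebraMap K Ω)).Splits :=
    IsSepClosed.splits_of_separable _ (hgsep.map)
  have hgi : (g.map A.subtype).map (algebraMap K Ω) = (g.map i).map B.subtype := by
    rw [Polynomial.map_map, Polynomial.map_map, hKi]
  have hxpos : 0 < V.v (((g.map A.subtype).map (algebraMap K Ω)).eval x) := by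
    rw [eval_map_algebraMap, ← hevalx, ← V.mem_maximalIdeal_iff,
      ← IsLocalRing.residue_eq_zero_iff, hres, hg, minpoly.aeval]
  rw [hsplit.eq_prod_roots_of_monic ((hgm.map _).map _)] at hxpos
  obtain ⟨a, har, hxa⟩ : ∃ a ∈ ((g.map A.subtype).map (algebraMap K Ω)).roots,
      0 < V.v (x - a) := by
    by_contra! hcon
    revert hcon hxpos
    generalize ((g.map A.subtype).map (algebraMap K Ω)).roots = R
    intro h hR
    refine absurd h (not_lt.2 ?_)
    clear h
    induction R using Multiset.induction_on with
    | empty => simp [V.v_one]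
    | cons b R ih =>
      rw [Multiset.map_cons, Multiset.prod_cons, eval_mul, V.v_mul, eval_sub, eval_X, eval_C]
      exact add_nonpos (hR b (Multiset.mem_cons_self b R))
        (ih fun c hc => hR c (Multiset.mem_cons_of_mem hc))
  have ha : 0 ≤ V.v a := by
    have := V.le_v_sub hx hxa.le
    rwa [sub_sub_cancel] at this
  let aB : B := ⟨a, ha⟩
  have hroot : ∀ b : B, (b : Ω) ∈ ((g.map A.subtype).map (algebraMap K Ω)).roots →
      (g.map i).eval b = 0 := fun b hb => by
    rw [mem_roots ((hgm.map _).map _).ne_zero, hgi, IsRoot.def] at hb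
    apply Subtype.ext
    refine Eq.trans ?_ hb
    rw [eval_map (f := B.subtype)]
    exact (eval₂_hom B.subtype b).symm
  have hder : V.v ((derivative (g.map i)).eval aB : B) = 0 := by
    rw [← V.isUnit_integers_iff, ← IsLocalRing.residue_ne_zero_iff_isUnit]
    have h1 : IsLocalRing.residue B aB = IsLocalRing.residue B xB := by
      rw [eq_comm, ← sub_eq_zero, ← map_sub, IsLocalRing.residue_eq_zero_iff,
        V.mem_maximalIdeal_iff]
      exact hxa
    have h2 := hsep.aeval_derivative_ne_zero (minpoly.aeval kA (IsLocalRing.residue B xB))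
    rwa [← hg, derivative_map, ← h1, ← hres, ← eval_map, ← derivative_map] at h2
  refine ⟨a, hxa, fun s hs => ?_⟩
  have hsa : 0 ≤ V.v (s a) := by rwa [v_inertia hs]
  let δ : B := ⟨s a, hsa⟩ - aB
  have hδ : 0 < V.v δ := hs.2.1 a ha
  have hsr : (s a) ∈ ((g.map A.subtype).map (algebraMap K Ω)).roots := by
    rw [mem_roots ((hgm.map _).map _).ne_zero, IsRoot.def] at har ⊢
    rw [eval_map] at har ⊢
    have h1 : (s : Ω →+* Ω).comp (algebraMap K Ω) = algebraMap K Ω :=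
      RingHom.ext fun z => inertia_apply hs ⟨z, rfl⟩
    have h2 := hom_eval₂ (g.map A.subtype) (algebraMap K Ω) (s : Ω →+* Ω) a
    rw [har, map_zero, h1] at h2
    exact h2.symm
  obtain ⟨k, hk⟩ := binomExpansion (g.map i) aB δ
  rw [hroot aB har, show aB + δ = ⟨s a, hsa⟩ by simp [δ], hroot ⟨s a, hsa⟩ hsr] at hk
  have hu : V.v ((derivative (g.map i)).eval aB + k * δ : B) = 0 := by
    rw [← hder]
    refine V.v_add_eq_left ?_
    rw [hder]
    exact hδ.trans_le (V.le_v_mul_left (V.mem_integers.1 k.2) le_rfl)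
  have hmul : (derivative (g.map i)).eval aB + k * δ = 0 ∨ δ = 0 := by
    rw [← mul_eq_zero, hk]; ring
  rcases hmul with h | h
  · rw [h] at hu
    exact absurd (hu.symm.trans V.v_zero) (by simp)
  · exact sub_eq_zero.1 (congrArg Subtype.val h)

end Unramified

section Approximation

variable {Ω : Type*} [Field Ω] (V : AddVal Ω)

/-- The subfield of elements fixed by the inertia group of `L`. -/
def hat (L : Set Ω) : Subfield Ω where
  carrier := {x | ∀ s ∈ V.inertia L, s x = x}
  zero_mem' s _ := map_zero s
  one_mem' s _ := map_one s
  add_mem' ha hb s hs := by rw [map_add, ha s hs, hb s hs]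
  mul_mem' ha hb s hs := by rw [map_mul, ha s hs, hb s hs]
  neg_mem' ha s hs := by rw [map_neg, ha s hs]
  inv_mem' x ha s hs := by rw [map_inv₀, ha s hs]

/-- Every residue class is represented by an element fixed by the inertia group of `L`. -/
def HasResidues (L : Set Ω) : Prop :=
  ∀ x, 0 ≤ V.v x → ∃ a ∈ V.hat L, 0 < V.v (x - a)

/-- The valuations of elements fixed by the inertia group of `L` are multiples of `1 / e`. -/
def HasValues (L : Set Ω) (e : ℕ) : Prop :=
  ∀ x ∈ V.hat L, x ≠ 0 → ∃ k : ℤ, V.v x = ((k / e : ℝ) : WithTop ℝ)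

variable {V} {L L' : Set Ω} {e : ℕ}

theorem hat_apply {x : Ω} (hx : x ∈ V.hat L) {s : Ω ≃+* Ω} (hs : s ∈ V.inertia L) : s x = x :=
  hx s hs

theorem subset_hat : L ⊆ V.hat L := fun _ hx _ hs => inertia_apply hs hx

theorem hat_mono (h : L ⊆ L') : V.hat L ≤ V.hat L' := fun _ hx s hs => hx s (inertia_mono h hs)

theorem HasResidues.mono (h : L ⊆ L') (hL : V.HasResidues L) : V.HasResidues L' := fun x hx =>
  (hL x hx).imp fun _ ha => ⟨hat_mono h ha.1, ha.2⟩

theorem HasValues.le_of_lt (hL : V.HasValues L e) (he : 0 < e) {x : Ω} (hx : x ∈ V.hat L) {n : ℤ}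
    (h : ((n / e : ℝ) : WithTop ℝ) < V.v x) : (((n + 1 : ℤ) / e : ℝ) : WithTop ℝ) ≤ V.v x := by
  by_cases hx0 : x = 0
  · simp [hx0, V.v_zero]
  obtain ⟨k, hk⟩ := hL x hx hx0
  have he' : (0 : ℝ) < e := by exact_mod_cast he
  rw [hk] at h ⊢
  rw [WithTop.coe_lt_coe, div_lt_div_iff_of_pos_right he'] at h
  rw [WithTop.coe_le_coe, div_le_div_iff_of_pos_right he']
  exact_mod_cast h

/-- Expansion of elements with respect to a system of elements with prescribed valuations. -/
theorem exists_expansion (hLL : L ⊆ L') (hres : V.HasResidues L) (hval : V.HasValues L' e)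
    (he : 0 < e) (w : ℕ → Ω) (hw : ∀ i, w i ∈ V.hat L')
    (hwv : ∀ i, V.v (w i) = ((i / e : ℝ) : WithTop ℝ)) {x : Ω} (hx : x ∈ V.hat L')
    (hx0 : 0 ≤ V.v x) (N : ℕ) :
    ∃ a : ℕ → Ω, (∀ i, a i ∈ V.hat L) ∧ (∀ i, 0 ≤ V.v (a i)) ∧
      ((N / e : ℝ) : WithTop ℝ) ≤ V.v (x - ∑ i ∈ Finset.range N, a i * w i) := by
  induction N with
  | zero =>
    refine ⟨0, fun _ => zero_mem _, fun i => by simp [V.v_zero], ?_⟩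
    simpa using hx0
  | succ N ih =>
    obtain ⟨a, ha, ha0, hN⟩ := ih
    set δ := x - ∑ i ∈ Finset.range N, a i * w i with hδ
    have hδm : δ ∈ V.hat L' := sub_mem hx
      (sum_mem fun i _ => mul_mem (hat_mono hLL (ha i)) (hw i))
    obtain ⟨b, hb, hbv⟩ := hres (δ / w N) (V.v_div_of_le (hwv N) (by simpa using hN))
    have hwN : w N ≠ 0 := by
      rintro h
      have := hwv N
      rw [h, V.v_zero] at this
      exact WithTop.coe_ne_top this.symm
    have hb0 : 0 ≤ V.v b := by
      have := V.le_v_sub (V.v_div_of_le (hwv N) (by simpa using hN : _ ≤ V.v δ)) hbv.le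
      rwa [sub_sub_cancel] at this
    refine ⟨Function.update a N b, fun i => ?_, fun i => ?_, ?_⟩
    · by_cases h : i = N
      · subst h; simpa using hb
      · simpa [h] using ha i
    · by_cases h : i = N
      · subst h; simpa using hb0
      · simpa [h] using ha0 i
    · have h1 : ∑ i ∈ Finset.range (N + 1), Function.update a N b i * w i =
          (∑ i ∈ Finset.range N, a i * w i) + b * w N := by
        rw [Finset.sum_range_succ, Function.update_self]
        congr 1
        refine Finset.sum_congr rfl fun i hi => ?_
        rw [Function.update_of_ne (Finset.mem_range.1 hi).ne]
      have h2 : x - ∑ i ∈ Finset.range (N + 1), Function.update a N b i * w i =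
          w N * (δ / w N - b) := by
        rw [h1, mul_sub, mul_div_cancel₀ _ hwN]
        simp only [hδ]; ring
      have h3 : ((((N : ℤ) : ℝ) / e : ℝ) : WithTop ℝ) < V.v (w N * (δ / w N - b)) := by
        rw [V.v_mul, hwv]
        have := WithTop.add_lt_add_left (WithTop.coe_ne_top (a := (N / e : ℝ))) hbv
        simpa using this
      rw [h2]
      have := hval.le_of_lt he (mul_mem (hw N) (sub_mem (div_mem hδm (hw N)) (hat_mono hLL hb))) h3
      simpa using this

theorem v_pow_sub_pow (x y : Ω) (hx : 0 ≤ V.v x) (hy : 0 ≤ V.v y) (n : ℕ) :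
    V.v (x - y) ≤ V.v (x ^ n - y ^ n) := by
  obtain ⟨c, hc⟩ := sub_dvd_pow_sub_pow (⟨x, hx⟩ : V.integers) ⟨y, hy⟩ n
  have h : x ^ n - y ^ n = c * (x - y) := by
    rw [mul_comm]; exact congrArg Subtype.val hc
  rw [h]
  exact V.le_v_mul_left (V.mem_integers.1 c.2) le_rfl

theorem lt_of_forall_nat (he : 0 < e) (c : ℝ) :
    ∃ N : ℕ, (c : WithTop ℝ) < ((N / e : ℝ) : WithTop ℝ) := by
  have he' : (0 : ℝ) < e := by exact_mod_cast he
  obtain ⟨N, hN⟩ := exists_nat_gt (c * e)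
  exact ⟨N, by rwa [WithTop.coe_lt_coe, lt_div_iff₀ he']⟩

/-- A uniformizer controls the displacement of all integral elements. -/
theorem v_displacement_le (hLL : L ⊆ L') (hres : V.HasResidues L) (hval : V.HasValues L' e)
    (he : 0 < e) {p : Ω} (hp : p ∈ V.hat L') (hpv : V.v p = ((1 / e : ℝ) : WithTop ℝ))
    {s : Ω ≃+* Ω} (hs : s ∈ V.inertia L) {x : Ω} (hx : x ∈ V.hat L') (hx0 : 0 ≤ V.v x) :
    V.v (s p - p) ≤ V.v (s x - x) := by
  by_contra! hcon
  obtain ⟨c, hc⟩ := WithTop.ne_top_iff_exists.1 hcon.ne_top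
  obtain ⟨N, hN⟩ := lt_of_forall_nat he c
  obtain ⟨a, ha, ha0, hN'⟩ := exists_expansion hLL hres hval he (fun i => p ^ i)
    (fun i => pow_mem hp i) (fun i => by rw [V.v_pow_eq hpv]; congr 1; ring) hx hx0 N
  have hp0 : 0 ≤ V.v p := by rw [hpv]; exact_mod_cast by positivity
  set δ := x - ∑ i ∈ Finset.range N, a i * p ^ i with hδ
  have h1 : s x - x = (∑ i ∈ Finset.range N, a i * ((s p) ^ i - p ^ i)) + (s δ - δ) := by
    have : s δ = s x - ∑ i ∈ Finset.range N, a i * (s p) ^ i := by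
      simp only [hδ, map_sub, map_sum, map_mul, map_pow, hat_apply (ha _) hs]
    rw [this, hδ]
    simp only [mul_sub, Finset.sum_sub_distrib]
    ring
  rw [← hc] at hcon
  refine absurd hc.symm (ne_of_gt ?_)
  rw [h1]
  refine V.lt_v_add (V.lt_v_sum _ _ WithTop.coe_ne_top fun i _ => ?_)
    (V.lt_v_sub (by rw [v_inertia hs]; exact hN.trans_le hN') (hN.trans_le hN'))
  exact hcon.trans_le (V.le_v_mul_left (ha0 i)
    (v_pow_sub_pow _ _ (by rwa [v_inertia hs]) hp0 i))

/-- An element of the inertia group fixing a uniformizer fixes everything. -/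
theorem mem_inertia_of_fixed (hLL : L ⊆ L') (hres : V.HasResidues L) (hval : V.HasValues L' e)
    (he : 0 < e) {p : Ω} (hp : p ∈ V.hat L') (hpv : V.v p = ((1 / e : ℝ) : WithTop ℝ))
    {s : Ω ≃+* Ω} (hs : s ∈ V.inertia L) (hsp : s p = p) : s ∈ V.inertia L' := by
  have h : ∀ x ∈ V.hat L', 0 ≤ V.v x → s x = x := fun x hx hx0 => by
    have := v_displacement_le hLL hres hval he hp hpv hs hx hx0
    rw [hsp, sub_self, V.v_zero, top_le_iff, V.v_eq_top_iff] at this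
    exact sub_eq_zero.1 this
  refine ⟨hs.1, hs.2.1, fun x hx => ?_⟩
  have hx' := subset_hat (V := V) hx
  rcases V.integers.mem_or_inv_mem x with h1 | h1
  · exact h x hx' h1
  · have := h _ (inv_mem hx') h1
    rwa [map_inv₀, inv_inj] at this

end Approximation

section Interpolation

variable {Ω : Type*} [Field Ω] (V : AddVal Ω)

theorem exists_le_v (S : Finset Ω) : ∃ c : ℝ, ∀ x ∈ S, (c : WithTop ℝ) ≤ V.v x := by
  induction S using Finset.induction_on with
  | empty => exact ⟨0, by simp⟩
  | insert a S _ ih =>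
    obtain ⟨c, hc⟩ := ih
    obtain ⟨d, hd⟩ : ∃ d : ℝ, (d : WithTop ℝ) ≤ V.v a := by
      by_cases h : a = 0
      · exact ⟨0, by simp [h, V.v_zero]⟩
      · exact (V.exists_v_eq h).imp fun _ h => h.ge
    refine ⟨min c d, fun x hx => ?_⟩
    rcases Finset.mem_insert.1 hx with rfl | hx
    · exact le_trans (by simp) hd
    · exact le_trans (by simp) (hc x hx)

/-- Polynomials of small degree which are small on `Y` have small coefficients. -/
theorem exists_le_v_coeff (Y : Finset Ω) : ∃ c : ℝ, ∀ r : Polynomial Ω, r.degree < Y.card →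
    ∀ N : ℝ, (∀ y ∈ Y, (N : WithTop ℝ) ≤ V.v (r.eval y)) →
      ∀ k, ((N + c : ℝ) : WithTop ℝ) ≤ V.v (r.coeff k) := by
  obtain ⟨c, hc⟩ := V.exists_le_v
    (Y.biUnion fun y => (Lagrange.basis Y id y).support.image (Lagrange.basis Y id y).coeff)
  have hc' : ∀ y ∈ Y, ∀ k, (c : WithTop ℝ) ≤ V.v ((Lagrange.basis Y id y).coeff k) := by
    intro y hy k
    by_cases h : (Lagrange.basis Y id y).coeff k = 0
    · simp [h, V.v_zero]
    · exact hc _ (Finset.mem_biUnion.2 ⟨y, hy, Finset.mem_image.2 ⟨k, mem_support_iff.2 h, rfl⟩⟩)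
  refine ⟨c, fun r hr N hN k => ?_⟩
  rw [Lagrange.eq_interpolate (s := Y) (v := id) Function.injective_id.injOn hr,
    Lagrange.interpolate_apply, finsetSum_coeff]
  refine V.le_v_sum _ _ fun y hy => ?_
  rw [coeff_C_mul, V.v_mul, WithTop.coe_add]
  exact add_le_add (hN y hy) (hc' y hy k)

end Interpolation

section Conjugates

variable {Ω : Type*} [Field Ω] {V : AddVal Ω}

variable (V) in
/-- `Y` is the orbit of `p` under the inertia group of `L`. -/
def IsOrbit (L : Set Ω) (p : Ω) (Y : Finset Ω) : Prop :=
  ∀ y, y ∈ Y ↔ ∃ s ∈ V.inertia L, s p = y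

namespace IsOrbit

variable {L : Set Ω} {p : Ω} {Y : Finset Ω}

theorem self_mem (hY : V.IsOrbit L p Y) : p ∈ Y := (hY p).2 ⟨1, one_mem _, rfl⟩

theorem v_eq (hY : V.IsOrbit L p Y) {y : Ω} (hy : y ∈ Y) : V.v y = V.v p := by
  obtain ⟨s, hs, rfl⟩ := (hY y).1 hy
  exact v_inertia hs p

theorem apply_mem (hY : V.IsOrbit L p Y) {s : Ω ≃+* Ω} (hs : s ∈ V.inertia L) {y : Ω}
    (hy : y ∈ Y) : s y ∈ Y := by
  obtain ⟨t, ht, rfl⟩ := (hY y).1 hy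
  exact (hY _).2 ⟨s * t, mul_mem hs ht, rfl⟩

theorem image_eq (hY : V.IsOrbit L p Y) {s : Ω ≃+* Ω} (hs : s ∈ V.inertia L) : Y.image s = Y :=
  Finset.eq_of_subset_of_card_le
    (Finset.image_subset_iff.2 fun _ hy => hY.apply_mem hs hy)
    (by rw [Finset.card_image_of_injective _ s.injective])

theorem prod_mem (hY : V.IsOrbit L p Y) : ∏ y ∈ Y, y ∈ V.hat L := fun s hs => by
  rw [map_prod]
  conv_rhs => rw [← hY.image_eq hs, Finset.prod_image s.injective.injOn]

theorem coeff_mem (hY : V.IsOrbit L p Y) (k : ℕ) : (∏ y ∈ Y, (X - C y)).coeff k ∈ V.hat L :=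
  fun s hs => by
    have h : (∏ y ∈ Y, (X - C y)).map (s : Ω →+* Ω) = ∏ y ∈ Y, (X - C y) := by
      rw [Polynomial.map_prod]
      conv_rhs => rw [← hY.image_eq hs, Finset.prod_image s.injective.injOn]
      simp
    conv_rhs => rw [← h]
    rw [coeff_map]; rfl

theorem le_v_eval (hY : V.IsOrbit L p Y) {P : Polynomial Ω} (hP : ∀ k, P.coeff k ∈ V.hat L)
    {c : WithTop ℝ} (h : c ≤ V.v (P.eval p)) {y : Ω} (hy : y ∈ Y) : c ≤ V.v (P.eval y) := by
  obtain ⟨s, hs, rfl⟩ := (hY y).1 hy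
  have h1 : P.map (s : Ω →+* Ω) = P := by
    ext k
    rw [coeff_map]
    exact hat_apply (hP k) hs
  have h2 : P.eval (s p) = s (P.eval p) := by
    conv_lhs => rw [← h1, eval_map]
    exact eval₂_hom (s : Ω →+* Ω) p
  rwa [h2, v_inertia hs]

end IsOrbit

variable {L₀ L₁ L₂ : Set Ω} {e₁ e₂ : ℕ} {p₁ p₂ : Ω} {Y : Finset Ω}

/-- The orbit of a uniformizer has as many elements as the relative ramification index. -/
theorem IsOrbit.card_mul (h01 : L₀ ⊆ L₁) (h12 : L₁ ⊆ L₂) (hres : V.HasResidues L₀)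
    (hval₁ : V.HasValues L₁ e₁) (hval₂ : V.HasValues L₂ e₂) (he₁ : 0 < e₁) (he₂ : 0 < e₂)
    (hp₁ : p₁ ∈ V.hat L₁) (hp₁v : V.v p₁ = ((1 / e₁ : ℝ) : WithTop ℝ))
    (hp₂ : p₂ ∈ V.hat L₂) (hp₂v : V.v p₂ = ((1 / e₂ : ℝ) : WithTop ℝ))
    (hY : V.IsOrbit L₁ p₂ Y) : Y.card * e₁ = e₂ := by
  have he₁' : (0 : ℝ) < e₁ := by exact_mod_cast he₁
  have he₂' : (0 : ℝ) < e₂ := by exact_mod_cast he₂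
  have ne_zero_of_v : ∀ {x : Ω} {c : ℝ}, V.v x = (c : WithTop ℝ) → x ≠ 0 := by
    rintro x c h rfl
    rw [V.v_zero] at h
    exact WithTop.coe_ne_top h.symm
  have hYpos : 0 < Y.card := Finset.card_pos.2 ⟨p₂, hY.self_mem⟩
  obtain ⟨d, hd⟩ : ∃ d : ℕ, d * e₁ = e₂ := by
    obtain ⟨k, hk⟩ := hval₂ p₁ (hat_mono h12 hp₁) (ne_zero_of_v hp₁v)
    rw [hp₁v, WithTop.coe_eq_coe] at hk
    have h1 : (k * e₁ : ℝ) = e₂ := by field_simp at hk; linarith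
    have h2 : (k * e₁ : ℤ) = e₂ := by exact_mod_cast h1
    have hk0 : 0 ≤ k := by
      by_contra! h
      have := mul_neg_of_neg_of_pos h (by exact_mod_cast he₁ : (0 : ℤ) < e₁)
      omega
    lift k to ℕ using hk0
    exact ⟨k, by exact_mod_cast h2⟩
  have hdpos : 0 < d := by
    rcases Nat.eq_zero_or_pos d with h | h
    · simp [h] at hd; omega
    · exact h
  have hle : e₂ ≤ Y.card * e₁ := by
    have hv : V.v (∏ y ∈ Y, y) = ((Y.card * (1 / e₂) : ℝ) : WithTop ℝ) := by
      rw [V.v_prod, Finset.sum_congr rfl fun y hy => (hY.v_eq hy).trans hp₂v, Finset.sum_const,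
        ← WithTop.coe_nsmul, nsmul_eq_mul]
    obtain ⟨k, hk⟩ := hval₁ _ hY.prod_mem (ne_zero_of_v hv)
    rw [hv, WithTop.coe_eq_coe] at hk
    have h1 : (Y.card * e₁ : ℝ) = k * e₂ := by field_simp at hk; linarith
    have h2 : (Y.card * e₁ : ℤ) = k * e₂ := by exact_mod_cast h1
    have h3 : (0 : ℤ) < k * e₂ := by rw [← h2]; positivity
    have h4 : 0 < k := pos_of_mul_pos_left h3 (by positivity)
    have h5 : (e₂ : ℤ) ≤ Y.card * e₁ := by rw [h2]; nlinarith
    exact_mod_cast h5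
  refine le_antisymm ?_ hle
  rw [← hd]
  refine Nat.mul_le_mul_right _ ?_
  by_contra! hlt
  obtain ⟨c, hc⟩ := V.exists_le_v_coeff Y
  obtain ⟨N, hN⟩ := lt_of_forall_nat he₂ (-c)
  obtain ⟨a, ha, -, hN'⟩ := exists_expansion (h01.trans h12) hres hval₂ he₂
    (fun i => p₁ ^ (i / d) * p₂ ^ (i % d))
    (fun i => mul_mem (pow_mem (hat_mono h12 hp₁) _) (pow_mem hp₂ _))
    (fun i => by
      rw [V.v_mul, V.v_pow_eq hp₁v, V.v_pow_eq hp₂v, ← WithTop.coe_add]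
      congr 1
      have h1 : (i : ℝ) = d * (i / d : ℕ) + (i % d : ℕ) := by
        exact_mod_cast (Nat.div_add_mod i d).symm
      have h2 : (e₂ : ℝ) = d * e₁ := by exact_mod_cast hd.symm
      have h3 : (d : ℝ) ≠ 0 := by exact_mod_cast hdpos.ne'
      rw [h2, h1]
      field_simp)
    (pow_mem hp₂ d) (V.v_pow_nonneg (by rw [hp₂v]; exact_mod_cast by positivity) d) N
  let P : Polynomial Ω :=
    X ^ d - ∑ i ∈ Finset.range N, C (a i * p₁ ^ (i / d)) * X ^ (i % d)
  have hPc : ∀ k, P.coeff k ∈ V.hat L₁ := fun k => by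
    simp only [P, coeff_sub, finsetSum_coeff, coeff_X_pow, coeff_C_mul]
    refine sub_mem (by split_ifs <;> simp) (sum_mem fun i _ => ?_)
    exact mul_mem (mul_mem (hat_mono h01 (ha i)) (pow_mem hp₁ _)) (by split_ifs <;> simp)
  have hPd : P.degree < Y.card := by
    refine (degree_sub_le _ _).trans_lt (max_lt ?_ ?_)
    · exact (degree_X_pow_le d).trans_lt (by exact_mod_cast hlt)
    · refine (degree_sum_le _ _).trans_lt ((Finset.sup_lt_iff ?_).2 fun i _ => ?_)
      · exact WithBot.bot_lt_coe _
      · refine (degree_C_mul_X_pow_le _ _).trans_lt ?_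
        exact_mod_cast (Nat.mod_lt i hdpos).trans hlt
  have hPe : ((N / e₂ : ℝ) : WithTop ℝ) ≤ V.v (P.eval p₂) := by
    simpa [P, eval_finsetSum, mul_assoc] using hN'
  have hP1 : P.coeff d = 1 := by
    simp only [P, coeff_sub, finsetSum_coeff, coeff_X_pow, coeff_C_mul, if_true]
    rw [Finset.sum_eq_zero, sub_zero]
    intro i _
    rw [if_neg (Nat.mod_lt i hdpos).ne', mul_zero]
  have h1 := hc P hPd _ (fun y hy => hY.le_v_eval hPc hPe hy) d
  rw [hP1, V.v_one] at h1
  norm_cast at h1 hN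
  linarith

/-- The displacement of a uniformizer is the product of displacements above it. -/
theorem IsOrbit.v_displacement (h01 : L₀ ⊆ L₁) (h12 : L₁ ⊆ L₂) (hres : V.HasResidues L₀)
    (hval₁ : V.HasValues L₁ e₁) (hval₂ : V.HasValues L₂ e₂) (he₁ : 0 < e₁) (he₂ : 0 < e₂)
    (hp₁ : p₁ ∈ V.hat L₁) (hp₁v : V.v p₁ = ((1 / e₁ : ℝ) : WithTop ℝ))
    (hp₂ : p₂ ∈ V.hat L₂) (hp₂v : V.v p₂ = ((1 / e₂ : ℝ) : WithTop ℝ))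
    (hY : V.IsOrbit L₁ p₂ Y) {t : Ω ≃+* Ω} (ht : t ∈ V.inertia L₀) :
    V.v (t p₁ - p₁) = ∑ y ∈ Y, V.v (t y - p₂) := by
  have hp₁0 : 0 ≤ V.v p₁ := by rw [hp₁v]; exact_mod_cast by positivity
  have hp₂0 : 0 ≤ V.v p₂ := by rw [hp₂v]; exact_mod_cast by positivity
  have hYint : ∀ y ∈ Y, 0 ≤ V.v y := fun y hy => by rwa [hY.v_eq hy]
  let f : Polynomial Ω := ∏ y ∈ Y, (X - C y)
  let τ : Ω →+* Ω := t
  have hfe : (f.map τ).eval p₂ = ∏ y ∈ Y, (p₂ - t y) := by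
    simp [f, τ, Polynomial.map_prod, eval_prod]
  have hfy : ∀ y ∈ Y, f.eval y = 0 := fun y hy => by
    rw [eval_prod]
    exact Finset.prod_eq_zero hy (by simp)
  have hsum : ∑ y ∈ Y, V.v (t y - p₂) = V.v ((f.map τ).eval p₂) := by
    rw [hfe, V.v_prod]
    exact Finset.sum_congr rfl fun y _ => V.v_sub_swap _ _
  rw [hsum]
  refine le_antisymm ?_ ?_
  · have h1 : (f.map τ).eval p₂ =
        ∑ k ∈ Finset.range (f.natDegree + 1), p₂ ^ k * (t (f.coeff k) - f.coeff k) := by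
      have h2 : (f.map τ).eval p₂ = (f.map τ).eval p₂ - f.eval p₂ := by
        rw [hfy p₂ hY.self_mem, sub_zero]
      rw [h2, eval_eq_sum_range, eval_eq_sum_range, natDegree_map, ← Finset.sum_sub_distrib]
      refine Finset.sum_congr rfl fun k _ => ?_
      rw [coeff_map]
      simp only [τ, RingEquiv.coe_toRingHom]
      ring
    rw [h1]
    exact V.le_v_sum _ _ fun k _ => V.le_v_mul_left (V.v_pow_nonneg hp₂0 k)
      (v_displacement_le h01 hres hval₁ he₁ hp₁ hp₁v ht (hY.coeff_mem k)
        (V.coeff_prod_nonneg Y hYint k))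
  · by_contra! hcon
    obtain ⟨b, hb⟩ := WithTop.ne_top_iff_exists.1 hcon.ne_top
    obtain ⟨c, hc⟩ := V.exists_le_v_coeff Y
    obtain ⟨N, hN⟩ := lt_of_forall_nat he₂ (max b (b - c))
    obtain ⟨a, ha, ha0, hN'⟩ := exists_expansion (h01.trans h12) hres hval₂ he₂
      (fun i => p₂ ^ i) (fun i => pow_mem hp₂ i)
      (fun i => by rw [V.v_pow_eq hp₂v]; congr 1; ring) (hat_mono h12 hp₁) hp₁0 N
    obtain ⟨f', hf'm, hf'⟩ := V.exists_integers_prod Y hYint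
    let B := V.integers
    let P' : B[X] := ∑ i ∈ Finset.range N, C (⟨a i, ha0 i⟩ : B) * X ^ i - C ⟨p₁, hp₁0⟩
    let P : Polynomial Ω := ∑ i ∈ Finset.range N, C (a i) * X ^ i - C p₁
    have hP' : P'.map B.subtype = P := by
      simp [P', P, Polynomial.map_sum]
    let r : Polynomial Ω := (P' %ₘ f').map B.subtype
    let h : Polynomial Ω := (P' /ₘ f').map B.subtype
    have hPr : r + f * h = P := by
      rw [← hP', show f = f'.map B.subtype from hf'.symm, ← Polynomial.map_mul,
        ← Polynomial.map_add, modByMonic_add_div P' f']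
    have hPc : ∀ k, P.coeff k ∈ V.hat L₁ := fun k => by
      simp only [P, coeff_sub, finsetSum_coeff, coeff_X_pow, coeff_C_mul, coeff_C]
      refine sub_mem (sum_mem fun i _ => ?_) (by split_ifs <;> simp [hp₁])
      exact mul_mem (hat_mono h01 (ha i)) (by split_ifs <;> simp)
    have hPe : ((N / e₂ : ℝ) : WithTop ℝ) ≤ V.v (P.eval p₂) := by
      rw [V.v_sub_swap] at hN'
      simpa [P, eval_finsetSum] using hN'
    have hrd : r.degree < Y.card := by
      refine degree_map_le.trans_lt ((degree_modByMonic_lt P' hf'm).trans_eq ?_)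
      rw [← degree_map_eq_of_injective (f := B.subtype) Subtype.val_injective, hf', degree_prod]
      simp
    have hre : ∀ y ∈ Y, ((N / e₂ : ℝ) : WithTop ℝ) ≤ V.v (r.eval y) := fun y hy => by
      have := hY.le_v_eval hPc hPe hy
      rwa [← hPr, eval_add, eval_mul, hfy y hy, zero_mul, add_zero] at this
    have hrc := hc r hrd _ hre
    have hev : p₁ - t p₁ =
        -P.eval p₂ + (r.map τ).eval p₂ + (h.map τ).eval p₂ * (f.map τ).eval p₂ := by
      have h1 : (P.map τ).eval p₂ = P.eval p₂ + p₁ - t p₁ := by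
        simp only [P, Polynomial.map_sub, Polynomial.map_sum, Polynomial.map_mul, map_C,
          Polynomial.map_pow, map_X, eval_sub, eval_finsetSum, eval_mul, eval_C, eval_pow, eval_X,
          τ, RingEquiv.coe_toRingHom, hat_apply (ha _) ht]
        ring
      have h2 := congrArg (fun q => (q.map τ).eval p₂) hPr
      simp only [Polynomial.map_add, Polynomial.map_mul, eval_add, eval_mul] at h2
      linear_combination -h2 - h1
    have hNb : (b : WithTop ℝ) < ((N / e₂ : ℝ) : WithTop ℝ) := lt_of_le_of_lt (by simp) hN
    have hNc : (b : WithTop ℝ) < ((N / e₂ + c : ℝ) : WithTop ℝ) := by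
      rw [WithTop.coe_lt_coe] at hN ⊢
      have := le_max_right b (b - c)
      linarith
    refine absurd hb (ne_of_lt ?_)
    rw [V.v_sub_swap, hev]
    refine V.lt_v_add (V.lt_v_add ?_ ?_) ?_
    · rw [V.v_neg]; exact hNb.trans_le hPe
    · rw [eval_eq_sum_range]
      refine hNc.trans_le (V.le_v_sum _ _ fun k _ => ?_)
      rw [mul_comm, coeff_map]
      refine V.le_v_mul_left (V.v_pow_nonneg hp₂0 k) ?_
      simp only [τ, RingEquiv.coe_toRingHom]
      rw [v_inertia ht]
      exact hrc k
    · rw [← hb] at hcon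
      refine hcon.trans_le (V.le_v_mul_left ?_ le_rfl)
      rw [eval_eq_sum_range]
      refine V.le_v_sum _ _ fun k _ => V.v_mul_nonneg ?_ (V.v_pow_nonneg hp₂0 k)
      rw [coeff_map]
      simp only [τ, RingEquiv.coe_toRingHom]
      rw [v_inertia ht, coeff_map]
      exact V.mem_integers.1 ((P' /ₘ f').coeff k).2

end Conjugates

section Truncation

/-- The truncation of `a` at the real number `c`. -/
def trunc (a : WithTop ℝ) (c : ℝ) : ℝ := (min a c).untopD 0

theorem coe_trunc (a : WithTop ℝ) (c : ℝ) : (trunc a c : WithTop ℝ) = min a c := by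
  cases a with
  | top => simp [trunc]
  | coe a => rw [trunc, ← WithTop.coe_min, WithTop.untopD_coe]

theorem le_trunc_iff {a : WithTop ℝ} {b c : ℝ} :
    b ≤ trunc a c ↔ (b : WithTop ℝ) ≤ a ∧ b ≤ c := by
  rw [← WithTop.coe_le_coe, coe_trunc, le_min_iff, WithTop.coe_le_coe]

theorem trunc_sum_min {ι : Type*} (Y : Finset ι) (a : ι → WithTop ℝ) (u : WithTop ℝ) (c : ℝ) :
    trunc (∑ y ∈ Y, min (a y) u) (∑ y ∈ Y, trunc (a y) c) = ∑ y ∈ Y, trunc (min (a y) u) c := by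
  rw [← WithTop.coe_eq_coe, coe_trunc, WithTop.coe_sum, WithTop.coe_sum]
  simp only [coe_trunc]
  rcases le_total u c with h | h
  · rw [min_eq_left (Finset.sum_le_sum fun y _ => min_le_min_left _ h)]
    exact Finset.sum_congr rfl fun y _ => (min_eq_left ((min_le_right _ _).trans h)).symm
  · rw [min_eq_right (Finset.sum_le_sum fun y _ => min_le_min_left _ h)]
    exact Finset.sum_congr rfl fun y _ => by rw [min_assoc, min_eq_right h]

theorem integral_indicator_le {a : WithTop ℝ} {e : ℕ} (he : 0 < e)
    (ha : ((1 / e : ℝ) : WithTop ℝ) ≤ a) {r : ℝ} (hr : 0 ≤ r) :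
    IntervalIntegrable (fun t : ℝ => if (((t + 1) / e : ℝ) : WithTop ℝ) ≤ a then (1 : ℝ) else 0)
      MeasureTheory.volume 0 r ∧
    ∫ t in (0 : ℝ)..r, (if (((t + 1) / e : ℝ) : WithTop ℝ) ≤ a then (1 : ℝ) else 0) =
      e * trunc a ((r + 1) / e) - 1 := by
  have he' : (0 : ℝ) < e := by exact_mod_cast he
  set m := e * trunc a ((r + 1) / e) - 1 with hm
  have hle : ∀ t : ℝ, t ≤ m ↔ (((t + 1) / e : ℝ) : WithTop ℝ) ≤ a ∧ t ≤ r := fun t => by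
    have h1 : t ≤ m ↔ (t + 1) / e ≤ trunc a ((r + 1) / e) := by
      rw [div_le_iff₀ he', hm]
      constructor <;> intro h <;> linarith
    rw [h1, le_trunc_iff, div_le_div_iff_of_pos_right he', add_le_add_iff_right]
  have hm0 : 0 ≤ m := (hle 0).2 ⟨by simpa using ha, hr⟩
  have hmr : m ≤ r := ((hle m).1 le_rfl).2
  have h1 : Set.EqOn (fun _ : ℝ => (1 : ℝ))
      (fun t : ℝ => if (((t + 1) / e : ℝ) : WithTop ℝ) ≤ a then (1 : ℝ) else 0)
      (Set.uIoc 0 m) := fun t ht => by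
    rw [Set.uIoc_of_le hm0] at ht
    exact (if_pos ((hle t).1 ht.2).1).symm
  have h2 : Set.EqOn (fun _ : ℝ => (0 : ℝ))
      (fun t : ℝ => if (((t + 1) / e : ℝ) : WithTop ℝ) ≤ a then (1 : ℝ) else 0)
      (Set.uIoc m r) := fun t ht => by
    rw [Set.uIoc_of_le hmr] at ht
    exact (if_neg fun h => ht.1.not_ge ((hle t).2 ⟨h, ht.2⟩)).symm
  have h3 := (intervalIntegrable_const (μ := MeasureTheory.volume)).congr h1
  have h4 := (intervalIntegrable_const (μ := MeasureTheory.volume)).congr h2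
  refine ⟨h3.trans h4, ?_⟩
  rw [← intervalIntegral.integral_add_adjacent_intervals h3 h4,
    ← intervalIntegral.integral_congr_ae (Filter.Eventually.of_forall h1),
    ← intervalIntegral.integral_congr_ae (Filter.Eventually.of_forall h2)]
  simp

end Truncation

section Ramification

variable {K Ω : Type*} [Field K] [Field Ω] [Algebra K Ω] {V : AddVal Ω}

theorem range_algebraMap_subset (E : IntermediateField K Ω) :
    Set.range (algebraMap K Ω) ⊆ (E : Set Ω) := by
  rintro _ ⟨x, rfl⟩
  exact E.algebraMap_mem x

theorem range_algebraMap_eq (E : IntermediateField K Ω) :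
    Set.range (algebraMap E Ω) = (E : Set Ω) := Subtype.range_coe

theorem herbrand_nonneg (V : AddVal Ω) (E : IntermediateField K Ω) (e : ℕ) {r : ℝ} (hr : 0 ≤ r) :
    0 ≤ herbrand V E e r :=
  intervalIntegral.integral_nonneg hr fun _ _ => by positivity

variable [IsGalois K Ω]

theorem HasResidues.of_perfect [IsSepClosed Ω] (hV : V.IsInvariantOver K)
    (hp : V.HasPerfectResidueFieldOn K) : V.HasResidues (Set.range (algebraMap K Ω)) :=
  fun _ hx => (exists_fixed_congr hV hp hx).imp fun _ h => ⟨h.2, h.1⟩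

theorem IsRamIdx.hasValues (hV : V.IsInvariantOver K) {E : IntermediateField K Ω} {e : ℕ}
    (he : V.IsRamIdx E e) : V.HasValues (E : Set Ω) e := fun x hx hx0 => by
  obtain ⟨z, hz⟩ := exists_v_eq_of_fixed (hV.intermediateField (E := E)) hx0
    (by rw [range_algebraMap_eq]; exact hx)
  have hz0 : z ≠ 0 := by
    rintro rfl
    rw [map_zero, V.v_zero] at hz
    exact V.v_ne_top x hx0 hz.symm
  rw [← hz]
  exact he.2.1 z hz0

theorem exists_isOrbit (p : Ω) : ∃ Y, V.IsOrbit (Set.range (algebraMap K Ω)) p Y := by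
  refine ⟨(conj K p).filter fun y => ∃ s ∈ V.inertia (Set.range (algebraMap K Ω)), s p = y,
    fun y => ?_⟩
  rw [Finset.mem_filter, and_iff_right_iff_imp]
  rintro ⟨s, hs, rfl⟩
  exact mem_conj.2 ⟨AlgEquiv.ofRingEquiv (f := s) fun x => inertia_apply hs ⟨x, rfl⟩, rfl⟩

variable {E : IntermediateField K Ω} {e : ℕ} {p : Ω} {Y : Finset Ω}

/-- The class of the inclusion is in bijection with the conjugates of a uniformizer close to it. -/
theorem gfun_eq_card (hV : V.IsInvariantOver K)
    (hres : V.HasResidues (Set.range (algebraMap K Ω))) (he : V.IsRamIdx E e)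
    (hp : p ∈ E) (hpv : V.v p = ((1 / e : ℝ) : WithTop ℝ))
    (hY : V.IsOrbit (Set.range (algebraMap K Ω)) p Y) {t : ℝ} (ht : 0 ≤ t) :
    gfun V E e t = (Y.filter fun y => (((t + 1) / e : ℝ) : WithTop ℝ) ≤ V.v (y - p)).card := by
  have hsub := range_algebraMap_subset E
  have hval := he.hasValues hV
  have hp0 : 0 ≤ V.v p := by rw [hpv]; exact_mod_cast by positivity
  have hpos : (0 : WithTop ℝ) < (((t + 1) / e : ℝ) : WithTop ℝ) := by
    have : (0 : ℝ) < e := by exact_mod_cast he.1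
    exact_mod_cast by positivity
  have hext : ∀ σ : E →ₐ[K] Ω, xiRel V E e t σ E.val →
      ∃ s ∈ V.inertia (Set.range (algebraMap K Ω)), ∀ x : E, s x = σ x := fun σ hσ =>
    exists_inertia_extends hV E σ fun x hx => hpos.trans_le (hσ x hx)
  have hmem : ∀ σ : {σ : E →ₐ[K] Ω // xiRel V E e t σ E.val}, σ.1 ⟨p, hp⟩ ∈
      Y.filter fun y => (((t + 1) / e : ℝ) : WithTop ℝ) ≤ V.v (y - p) := fun σ => by
    obtain ⟨s, hs, hsσ⟩ := hext σ.1 σ.2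
    exact Finset.mem_filter.2 ⟨(hY _).2 ⟨s, hs, hsσ ⟨p, hp⟩⟩, σ.2 ⟨p, hp⟩ hp0⟩
  rw [gfun, ← Nat.card_eq_finsetCard]
  refine Nat.card_congr (Equiv.ofBijective (fun σ => ⟨_, hmem σ⟩) ⟨fun σ τ h => ?_, ?_⟩)
  · obtain ⟨s, hs, hsσ⟩ := hext σ.1 σ.2
    obtain ⟨u, hu, huτ⟩ := hext τ.1 τ.2
    have h1 : s p = u p := by
      rw [hsσ ⟨p, hp⟩, huτ ⟨p, hp⟩]
      exact congrArg Subtype.val h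
    have h2 : (u⁻¹ * s) ∈ V.inertia (E : Set Ω) :=
      mem_inertia_of_fixed hsub hres hval he.1 (subset_hat hp) hpv (mul_mem (inv_mem hu) hs)
        (u.symm_apply_eq.2 h1)
    refine Subtype.ext (AlgHom.ext fun x => ?_)
    rw [← hsσ, ← huτ]
    exact u.symm_apply_eq.1 (inertia_apply h2 x.2)
  · rintro ⟨y, hy⟩
    obtain ⟨hyY, hyv⟩ := Finset.mem_filter.1 hy
    obtain ⟨s, hs, rfl⟩ := (hY y).1 hyY
    let σ : Ω ≃ₐ[K] Ω := AlgEquiv.ofRingEquiv (f := s) fun x => inertia_apply hs ⟨x, rfl⟩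
    refine ⟨⟨σ.toAlgHom.comp E.val, fun x hx => hyv.trans ?_⟩, rfl⟩
    exact v_displacement_le hsub hres hval he.1 (subset_hat hp) hpv hs (subset_hat x.2) hx

/-- The Herbrand function in terms of the conjugates of a uniformizer. -/
theorem herbrand_add_one (hV : V.IsInvariantOver K)
    (hres : V.HasResidues (Set.range (algebraMap K Ω))) (he : V.IsRamIdx E e)
    (hp : p ∈ E) (hpv : V.v p = ((1 / e : ℝ) : WithTop ℝ))
    (hY : V.IsOrbit (Set.range (algebraMap K Ω)) p Y) {r : ℝ} (hr : 0 ≤ r) :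
    herbrand V E e r + 1 = e / Y.card * ∑ y ∈ Y, trunc (V.v (y - p)) ((r + 1) / e) := by
  have hge : ∀ y ∈ Y, ((1 / e : ℝ) : WithTop ℝ) ≤ V.v (y - p) := fun y hy =>
    V.le_v_sub ((hY.v_eq hy).trans hpv).ge hpv.ge
  have hY0 : (Y.card : ℝ) ≠ 0 := by
    exact_mod_cast (Finset.card_pos.2 ⟨p, hY.self_mem⟩).ne'
  have h0 : gfun V E e 0 = Y.card := by
    rw [gfun_eq_card hV hres he hp hpv hY le_rfl, Finset.filter_true_of_mem]
    simpa using hge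
  have h1 : herbrand V E e r = ∫ t in (0 : ℝ)..r, ∑ y ∈ Y,
      (if (((t + 1) / e : ℝ) : WithTop ℝ) ≤ V.v (y - p) then (1 : ℝ) else 0) / Y.card := by
    refine intervalIntegral.integral_congr fun t ht => ?_
    rw [Set.uIcc_of_le hr] at ht
    rw [h0, gfun_eq_card hV hres he hp hpv hY ht.1, ← Finset.sum_div, Finset.sum_boole]
  rw [h1, intervalIntegral.integral_finsetSum fun y hy =>
    (integral_indicator_le he.1 (hge y hy) hr).1.div_const _]
  have h2 : ∀ y ∈ Y, ∫ t in (0 : ℝ)..r,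
      (if (((t + 1) / e : ℝ) : WithTop ℝ) ≤ V.v (y - p) then (1 : ℝ) else 0) / Y.card =
      (e * trunc (V.v (y - p)) ((r + 1) / e) - 1) / Y.card := fun y hy => by
    rw [intervalIntegral.integral_div, (integral_indicator_le he.1 (hge y hy) hr).2]
  rw [Finset.sum_congr rfl h2, ← Finset.sum_div, Finset.sum_sub_distrib, ← Finset.mul_sum,
    Finset.sum_const, nsmul_eq_mul]
  field_simp
  ring

end Ramification

section Tower

variable {Ω : Type*} [Field Ω] {V : AddVal Ω}
  {L₀ L₁ L₂ : Set Ω} {e₁ e₂ : ℕ} {p₁ p₂ : Ω} {X₁ X₂ Y : Finset Ω}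

/-- Translates of `p₂` above a given conjugate of `p₁`, measured from a closest one. -/
theorem IsOrbit.exists_closest (h01 : L₀ ⊆ L₁) (hp₁ : p₁ ∈ V.hat L₁)
    (hX₁ : V.IsOrbit L₀ p₁ X₁) (hX₂ : V.IsOrbit L₀ p₂ X₂) (hY : V.IsOrbit L₁ p₂ Y)
    {q : Ω} (hq : q ∈ X₁) :
    ∃ t ∈ V.inertia L₀, t p₁ = q ∧
      ∀ y ∈ Y, V.v (t y - p₂) = min (V.v (y - p₂)) (V.v (t p₂ - p₂)) := by
  obtain ⟨s, hs, hsq⟩ := (hX₁ q).1 hq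
  obtain ⟨z, hz, hmax⟩ := Finset.exists_max_image
    (X₂.filter fun z => ∃ t ∈ V.inertia L₀, t p₁ = q ∧ t p₂ = z) (fun z => V.v (z - p₂))
    ⟨s p₂, Finset.mem_filter.2 ⟨(hX₂ _).2 ⟨s, hs, rfl⟩, s, hs, hsq, rfl⟩⟩
  obtain ⟨-, t, ht, htq, rfl⟩ := Finset.mem_filter.1 hz
  refine ⟨t, ht, htq, fun y hy => ?_⟩
  obtain ⟨g, hg, rfl⟩ := (hY y).1 hy
  have hg0 := inertia_mono h01 hg
  have hle : V.v (t (g p₂) - p₂) ≤ V.v (t p₂ - p₂) := by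
    refine hmax _ (Finset.mem_filter.2 ⟨(hX₂ _).2 ⟨t * g, mul_mem ht hg0, rfl⟩, t * g,
      mul_mem ht hg0, ?_, rfl⟩)
    rw [← htq]
    exact congrArg t (hat_apply hp₁ hg)
  have h1 : t (g p₂) - p₂ = t (g p₂ - p₂) + (t p₂ - p₂) := by
    rw [map_sub]; ring
  have h2 : V.v (t (g p₂ - p₂)) = V.v (g p₂ - p₂) := v_inertia ht _
  refine le_antisymm (le_min ?_ hle) ?_
  · by_contra! hlt
    refine hlt.ne ?_
    rw [← h2, h1, V.v_add_eq_left]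
    rw [h2]
    exact hlt.trans_le hle
  · rw [h1]
    exact V.le_v_add (by rw [h2]; exact min_le_left _ _) (min_le_right _ _)

/-- Conjugates of `p₂` are parametrized by conjugates of `p₁` and relative conjugates. -/
theorem IsOrbit.sum_eq {M : Type*} [AddCommMonoid M] (h01 : L₀ ⊆ L₁) (h12 : L₁ ⊆ L₂)
    (hres : V.HasResidues L₀)
    (hval₁ : V.HasValues L₁ e₁) (hval₂ : V.HasValues L₂ e₂) (he₁ : 0 < e₁) (he₂ : 0 < e₂)
    (hp₁ : p₁ ∈ V.hat L₁) (hp₁v : V.v p₁ = ((1 / e₁ : ℝ) : WithTop ℝ))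
    (hp₂ : p₂ ∈ V.hat L₂) (hp₂v : V.v p₂ = ((1 / e₂ : ℝ) : WithTop ℝ))
    (hX₁ : V.IsOrbit L₀ p₁ X₁) (hX₂ : V.IsOrbit L₀ p₂ X₂) (hY : V.IsOrbit L₁ p₂ Y)
    (t : Ω → Ω ≃+* Ω) (ht : ∀ q ∈ X₁, t q ∈ V.inertia L₀) (htq : ∀ q ∈ X₁, t q p₁ = q)
    (h : Ω → M) : ∑ z ∈ X₂, h z = ∑ q ∈ X₁, ∑ y ∈ Y, h (t q y) := by
  rw [← Finset.sum_product']
  symm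
  refine Finset.sum_nbij (fun z => t z.1 z.2) ?_ ?_ ?_ fun _ _ => rfl
  · rintro ⟨q, y⟩ hqy
    obtain ⟨hq, hy⟩ := Finset.mem_product.1 hqy
    obtain ⟨s, hs, rfl⟩ := (hY y).1 hy
    exact (hX₂ _).2 ⟨t q * s, mul_mem (ht q hq) (inertia_mono h01 hs), rfl⟩
  · rintro ⟨q, y⟩ hqy ⟨q', y'⟩ hqy' heq
    obtain ⟨hq, hy⟩ := Finset.mem_product.1 hqy
    obtain ⟨hq', hy'⟩ := Finset.mem_product.1 hqy'
    obtain ⟨s, hs, hsy⟩ := (hY y).1 hy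
    obtain ⟨s', hs', hsy'⟩ := (hY y').1 hy'
    simp only at heq
    have h1 : (t q' * s')⁻¹ * (t q * s) ∈ V.inertia L₂ := by
      refine mem_inertia_of_fixed (h01.trans h12) hres hval₂ he₂ hp₂ hp₂v
        (mul_mem (inv_mem (mul_mem (ht q' hq') (inertia_mono h01 hs')))
          (mul_mem (ht q hq) (inertia_mono h01 hs))) ((t q' * s').symm_apply_eq.2 ?_)
      change t q (s p₂) = t q' (s' p₂)
      rw [hsy, hsy', heq]
    have h2 : t q (s p₁) = t q' (s' p₁) :=
      (t q' * s').symm_apply_eq.1 (hat_apply (hat_mono h12 hp₁) h1)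
    rw [hat_apply hp₁ hs, hat_apply hp₁ hs', htq q hq, htq q' hq'] at h2
    subst h2
    rw [(t q).injective heq]
  · intro z hz
    obtain ⟨g, hg, rfl⟩ := (hX₂ z).1 hz
    have hq : g p₁ ∈ X₁ := (hX₁ _).2 ⟨g, hg, rfl⟩
    have h1 : (t (g p₁))⁻¹ * g ∈ V.inertia L₁ :=
      mem_inertia_of_fixed h01 hres hval₁ he₁ hp₁ hp₁v (mul_mem (inv_mem (ht _ hq)) hg)
        ((t (g p₁)).symm_apply_eq.2 (htq _ hq).symm)
    refine ⟨(g p₁, (t (g p₁)).symm (g p₂)), Finset.mem_coe.2 (Finset.mem_product.2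
      ⟨hq, (hY _).2 ⟨_, h1, rfl⟩⟩), ?_⟩
    exact (t (g p₁)).apply_symm_apply _

/-- The combinatorial form of the transitivity of Herbrand functions. -/
theorem IsOrbit.sum_trunc (h01 : L₀ ⊆ L₁) (h12 : L₁ ⊆ L₂) (hres : V.HasResidues L₀)
    (hval₁ : V.HasValues L₁ e₁) (hval₂ : V.HasValues L₂ e₂) (he₁ : 0 < e₁) (he₂ : 0 < e₂)
    (hp₁ : p₁ ∈ V.hat L₁) (hp₁v : V.v p₁ = ((1 / e₁ : ℝ) : WithTop ℝ))
    (hp₂ : p₂ ∈ V.hat L₂) (hp₂v : V.v p₂ = ((1 / e₂ : ℝ) : WithTop ℝ))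
    (hX₁ : V.IsOrbit L₀ p₁ X₁) (hX₂ : V.IsOrbit L₀ p₂ X₂) (hY : V.IsOrbit L₁ p₂ Y) :
    X₂.card = X₁.card * Y.card ∧ ∀ c : ℝ, ∑ z ∈ X₂, trunc (V.v (z - p₂)) c =
      ∑ q ∈ X₁, trunc (V.v (q - p₁)) (∑ y ∈ Y, trunc (V.v (y - p₂)) c) := by
  choose! t ht htq htv using fun q (hq : q ∈ X₁) => hX₁.exists_closest h01 hp₁ hX₂ hY hq
  have hsum := fun {M : Type} [AddCommMonoid M] (h : Ω → M) => hX₁.sum_eq h01 h12 hres hval₁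
    hval₂ he₁ he₂ hp₁ hp₁v hp₂ hp₂v hX₂ hY t ht htq h
  refine ⟨by simpa using hsum fun _ => (1 : ℕ), fun c => ?_⟩
  rw [hsum]
  refine Finset.sum_congr rfl fun q hq => ?_
  have h1 : V.v (q - p₁) = ∑ y ∈ Y, min (V.v (y - p₂)) (V.v (t q p₂ - p₂)) := by
    conv_lhs => rw [← htq q hq]
    rw [hY.v_displacement h01 h12 hres hval₁ hval₂ he₁ he₂ hp₁ hp₁v hp₂ hp₂v (ht q hq)]
    exact Finset.sum_congr rfl (htv q hq)
  rw [h1, trunc_sum_min]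
  exact Finset.sum_congr rfl fun y hy => by rw [htv q hq y hy]

end Tower

end AddVal

/-- Transitivity of Herbrand functions in a tower `E₂/E₁/F` of finitely
ramified separable extensions: `φ_{E₂/F} = φ_{E₁/F} ∘ φ_{E₂/E₁}` on `[0,∞)`.
Here `E₂'` denotes `E₂` regarded as an extension of `E₁` (same underlying subfield of
`Ω = F^sep`), and the Herbrand function of `E₂/E₁` is computed with respect to the same
ambient valuation `V` (whose value group on `E₂` is `(1/e₂)ℤ`). -/
theorem herbrand_tower
    {F Ω : Type*} [Field F] [Field Ω] [Algebra F Ω] [IsSepClosure F Ω]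
    (V : AddVal Ω) (hnorm : V.IsNormalizedOn F) (hhens : V.IsHenselianOn F)
    (hperf : V.HasPerfectResidueFieldOn F)
    (E₁ E₂ : IntermediateField F Ω) (h12 : E₁ ≤ E₂)
    (e₁ e₂ : ℕ) (he₁ : V.IsRamIdx E₁ e₁) (he₂ : V.IsRamIdx E₂ e₂)
    (E₂' : IntermediateField ↥E₁ Ω) (hE₂' : ∀ x : Ω, x ∈ E₂' ↔ x ∈ E₂) :
    ∀ r : ℝ, 0 ≤ r →
      herbrand V E₂ e₂ r = herbrand V E₁ e₁ (herbrand V E₂' e₂ r) := by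
  intro r hr
  have : IsSepClosed Ω := IsSepClosure.sep_closed F
  have hV : V.IsInvariantOver F := V.v_algEquiv hhens
  have hres := AddVal.HasResidues.of_perfect hV hperf
  have hres₁ : V.HasResidues (Set.range (algebraMap E₁ Ω)) := by
    rw [AddVal.range_algebraMap_eq]
    exact hres.mono (AddVal.range_algebraMap_subset E₁)
  have he₂' : V.IsRamIdx E₂' e₂ := by
    refine ⟨he₂.1, fun x hx => he₂.2.1 ⟨x, (hE₂' x).1 x.2⟩ fun h => hx (Subtype.ext ?_), ?_⟩
    · exact congrArg (fun z : E₂ => (z : Ω)) h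
    · obtain ⟨x, hx⟩ := he₂.2.2
      exact ⟨⟨x, (hE₂' x).2 x.2⟩, hx⟩
  obtain ⟨⟨p₁, hp₁⟩, hp₁v⟩ := he₁.2.2
  obtain ⟨⟨p₂, hp₂⟩, hp₂v⟩ := he₂.2.2
  obtain ⟨X₁, hX₁⟩ := AddVal.exists_isOrbit (K := F) (V := V) p₁
  obtain ⟨X₂, hX₂⟩ := AddVal.exists_isOrbit (K := F) (V := V) p₂
  obtain ⟨Y, hY⟩ := AddVal.exists_isOrbit (K := E₁) (V := V) p₂
  have hf₁ := fun {s : ℝ} => AddVal.herbrand_add_one hV hres he₁ hp₁ hp₁v hX₁ (r := s)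
  have hf₂ := AddVal.herbrand_add_one hV hres he₂ hp₂ hp₂v hX₂ hr
  have hf := AddVal.herbrand_add_one (hV.intermediateField E₁) hres₁ he₂' ((hE₂' p₂).2 hp₂) hp₂v hY hr
  rw [AddVal.range_algebraMap_eq] at hY
  have h01 := AddVal.range_algebraMap_subset E₁
  have hL12 : (E₁ : Set Ω) ⊆ E₂ := h12
  have hval₁ := he₁.hasValues hV
  have hval₂ := he₂.hasValues hV
  have hcard := hY.card_mul h01 hL12 hres hval₁ hval₂ he₁.1 he₂.1 (AddVal.subset_hat hp₁) hp₁v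
    (AddVal.subset_hat hp₂) hp₂v
  obtain ⟨hX, htr⟩ := hX₁.sum_trunc h01 hL12 hres hval₁ hval₂ he₁.1 he₂.1
    (AddVal.subset_hat hp₁) hp₁v (AddVal.subset_hat hp₂) hp₂v hX₂ hY
  have he₁0 : (e₁ : ℝ) ≠ 0 := by exact_mod_cast he₁.1.ne'
  have hX₁0 : (X₁.card : ℝ) ≠ 0 := by
    exact_mod_cast (Finset.card_pos.2 ⟨p₁, hX₁.self_mem⟩).ne'
  have hY0 : (Y.card : ℝ) ≠ 0 := by
    exact_mod_cast (Finset.card_pos.2 ⟨p₂, hY.self_mem⟩).ne'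
  have hc : (e₂ : ℝ) = Y.card * e₁ := by exact_mod_cast hcard.symm
  have hX' : (X₂.card : ℝ) = X₁.card * Y.card := by exact_mod_cast hX
  have hs : (herbrand V E₂' e₂ r + 1) / e₁ =
      ∑ y ∈ Y, AddVal.trunc (V.v (y - p₂)) ((r + 1) / e₂) := by
    rw [hf]
    nth_rewrite 1 [hc]
    field_simp
  have hfin := hf₁ (AddVal.herbrand_nonneg V E₂' e₂ hr)
  rw [hs, ← htr] at hfin
  rw [← add_left_inj (1 : ℝ), hfin, hf₂, hX']
  nth_rewrite 1 [hc]
  field_simp
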